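/- arXiv:2303.14629 — 2 statements merged into one kernel-verified Lean document; each statement's English description precedes it below -/
import Mathlib

section
/- Let 1 ≤ m ≤ n be integers and let g : ℝ^m → ℝ be a continuous symmetric function. Define f on the unit sphere S^{2mn−1} of ℂ^m ⊗ ℂ^n by f(u) = g(p_1(u),…,p_m(u)), where p_1(u),…,p_m(u) are the eigenvalues of the reduced density matrix ρ(u) (equivalently, the squares of the Schmidt coefficients of u). Then ∫_{S^{2mn−1}} f(u) dμ(u) = [∫_{T_m} g(p_1/Σ_k p_k, …, p_m/Σ_k p_k) · Π_{1≤j<k≤m}(p_k − p_j)² · Π_{j=1}^m p_j^{n−m} dp_1…dp_m] / [∫_{T_m} Π_{1≤j<k≤m}(p_k − p_j)² · Π_{j=1}^m p_j^{n−m} dp_1…dp_m], where T_m = {(x_1,…,x_m) ∈ ℝ^m : x_1,…,x_m ≥ 0 and x_1+…+x_m ≤ 1}. -/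
open MeasureTheory Matrix

noncomputable section

instance (ι : Type*) [Fintype ι] : MeasurableSpace (EuclideanSpace ℂ ι) := borel _
instance (ι : Type*) [Fintype ι] : BorelSpace (EuclideanSpace ℂ ι) := ⟨rfl⟩
instance (ι : Type*) [Fintype ι] : InnerProductSpace ℝ (EuclideanSpace ℂ ι) :=
  InnerProductSpace.rclikeToReal ℂ _

/-- The model for `ℂ^m ⊗ ℂ^n`: a Euclidean space indexed by `Fin m × Fin n`,
so that a vector is identified with the matrix of its coefficients in the
fixed (standard) orthonormal bases. -/
abbrev TensorSp (m n : ℕ) := EuclideanSpace ℂ (Fin m × Fin n)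

/-- The coefficient matrix `A(v)` of `v ∈ ℂ^m ⊗ ℂ^n`. -/
def coeffMatrix {m n : ℕ} (v : TensorSp m n) : Matrix (Fin m) (Fin n) ℂ :=
  Matrix.of fun j k => v (j, k)

/-- The reduced density matrix `ρ(v) = A(v) A(v)*`. -/
def redDensity {m n : ℕ} (v : TensorSp m n) : Matrix (Fin m) (Fin m) ℂ :=
  coeffMatrix v * (coeffMatrix v)ᴴ

theorem redDensity_isHermitian {m n : ℕ} (v : TensorSp m n) :
    (redDensity v).IsHermitian :=
  Matrix.isHermitian_mul_conjTranspose_self _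

/-- The eigenvalues `p_1(v), …, p_m(v)` of the reduced density matrix
(the squares of the Schmidt coefficients of `v`). -/
def schmidtSq {m n : ℕ} (v : TensorSp m n) : Fin m → ℝ :=
  (redDensity_isHermitian v).eigenvalues

/-- The entanglement entropy `E(v) = -∑ p_j ln p_j` (recall `Real.log 0 = 0`,
which implements the convention `0 · ln 0 = 0`). -/
def entEntropy {m n : ℕ} (v : TensorSp m n) : ℝ :=
  -∑ j, schmidtSq v j * Real.log (schmidtSq v j)

/-- The uniform (rotation-invariant) probability measure on the unit sphere
`S^{2mn-1}` of `ℂ^m ⊗ ℂ^n`: the normalization of the measure induced on the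
sphere by the Lebesgue (Haar) measure of the ambient Euclidean space. -/
def sphereUniform (m n : ℕ) : Measure (Metric.sphere (0 : TensorSp m n) 1) :=
  ((volume : Measure (TensorSp m n)).toSphere Set.univ)⁻¹ •
    (volume : Measure (TensorSp m n)).toSphere

/-- The corner simplex `T_m = {x ∈ ℝ^m : x_j ≥ 0, ∑ x_j ≤ 1}`. -/
def cornerSimplex (m : ℕ) : Set (Fin m → ℝ) :=
  {p | (∀ j, 0 ≤ p j) ∧ ∑ j, p j ≤ 1}

open Polynomial in
/-- Monic polynomials of degree `n` that agree at `n` distinct points are equal. -/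
theorem monic_eq_of_eval_eq {K : Type*} [Field K] {n : ℕ} {p r : K[X]} (hp : p.Monic)
    (hr : r.Monic) (hpn : p.natDegree = n) (hrn : r.natDegree = n) (q : Fin n → K)
    (hq : Function.Injective q) (h : ∀ i, p.eval (q i) = r.eval (q i)) : p = r := by
  refine eq_of_degree_sub_lt_of_eval_index_eq Finset.univ (v := q) hq.injOn ?_
    (fun i _ => h i)
  have hd : p.degree = r.degree := by
    rw [degree_eq_natDegree hp.ne_zero, degree_eq_natDegree hr.ne_zero, hpn, hrn]
  have := degree_sub_lt_left hd hp.ne_zero (by rw [hp.leadingCoeff, hr.leadingCoeff])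
  rw [degree_eq_natDegree hp.ne_zero, hpn] at this
  simpa using this

open Polynomial in
/-- A monotone tuple is determined by the monic polynomial having it as its tuple of roots. -/
theorem eq_of_prod_X_sub_C_eq {n : ℕ} {p r : Fin n → ℝ} (hp : Monotone p) (hr : Monotone r)
    (h : ∏ i, (X - C (p i)) = ∏ i, (X - C (r i))) : p = r := by
  have hm : Multiset.map p Finset.univ.val = Multiset.map r Finset.univ.val := by
    have hroots : ∀ s : Fin n → ℝ,
        (∏ i, (X - C (s i))).roots = Multiset.map s Finset.univ.val := fun s => by
      rw [← roots_multiset_prod_X_sub_C (Multiset.map s Finset.univ.val), Multiset.map_map]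
      rfl
    rw [← hroots, ← hroots, h]
  have hl : List.ofFn p = List.ofFn r := by
    refine List.Perm.eq_of_pairwise (le := (· ≤ ·)) (fun a b _ _ h1 h2 => le_antisymm h1 h2)
      ?_ ?_ ?_
    · exact (List.sortedLE_ofFn_iff.2 hp).pairwise
    · exact (List.sortedLE_ofFn_iff.2 hr).pairwise
    · rw [← Multiset.coe_eq_coe]
      simpa [Fin.univ_def, List.ofFn_eq_map] using hm
  exact List.ofFn_injective hl

/-- The Vandermonde product `∏_{i<j} (p_j - p_i)`. -/
def vdm {m : ℕ} (p : Fin m → ℝ) : ℝ := ∏ i, ∏ j ∈ Finset.Ioi i, (p j - p i)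

theorem det_vandermonde_eq_vdm {m : ℕ} (p : Fin m → ℝ) : (vandermonde p).det = vdm p :=
  det_vandermonde p

theorem vdm_pos {m : ℕ} {p : Fin m → ℝ} (hp : StrictMono p) : 0 < vdm p :=
  Finset.prod_pos fun _ _ => Finset.prod_pos fun _ hj =>
    sub_pos.2 (hp (Finset.mem_Ioi.1 hj))

theorem continuous_vdm {m : ℕ} : Continuous (vdm : (Fin m → ℝ) → ℝ) := by
  unfold vdm; fun_prop

theorem abs_prod_prod_erase_sub {m : ℕ} (p : Fin m → ℝ) :
    |∏ i, ∏ j ∈ Finset.univ.erase i, (p i - p j)| = vdm p ^ 2 := by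
  have h := Finset.prod_prod_Ioi_mul_eq_prod_prod_off_diag (fun i j => p j - p i)
  have h2 : ∀ i, Finset.univ.erase i = ({i}ᶜ : Finset (Fin m)) := fun i => by ext; simp
  simp_rw [h2]
  rw [← h]
  simp_rw [Finset.abs_prod, vdm, ← Finset.prod_pow]
  refine Finset.prod_congr rfl fun i _ => Finset.prod_congr rfl fun j _ => ?_
  rw [show (p i - p j) * (p j - p i) = -(p j - p i) ^ 2 by ring, abs_neg,
    abs_of_nonneg (sq_nonneg _)]

open Polynomial in
/-- The determinant of Cauchy type `det (∏_{l ≠ j} (q_i - μ_l))`, up to sign. -/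
theorem abs_det_prod_erase_sub {m : ℕ} (q μ : Fin m → ℝ) (hμ : StrictMono μ) :
    |(Matrix.of fun i j => ∏ l ∈ Finset.univ.erase j, (q i - μ l)).det| = |vdm q| * vdm μ := by
  let f : Fin m → ℝ[X] := fun j => ∏ l ∈ Finset.univ.erase j, (X - C (μ l))
  let c : Matrix (Fin m) (Fin m) ℝ := Matrix.of fun k j => (f j).coeff k
  have key : ∀ r : Fin m → ℝ,
      (Matrix.of fun i j => ∏ l ∈ Finset.univ.erase j, (r i - μ l)) = vandermonde r * c := by
    intro r
    ext i j
    have hdeg : (f j).natDegree < m := by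
      rw [natDegree_prod_of_monic _ _ fun l _ => monic_X_sub_C _]
      simp only [natDegree_X_sub_C, Finset.sum_const, Finset.card_erase_of_mem (Finset.mem_univ j),
        Finset.card_univ, Fintype.card_fin, smul_eq_mul, mul_one]
      have := j.pos
      omega
    have : (f j).eval (r i) = ∏ l ∈ Finset.univ.erase j, (r i - μ l) := by
      simp [f, eval_prod]
    rw [Matrix.of_apply, ← this, eval_eq_sum_range' hdeg, Finset.sum_range, Matrix.mul_apply]
    refine Finset.sum_congr rfl fun k _ => ?_
    simp [vandermonde_apply, c, mul_comm]
  have hd : (Matrix.of fun i j => ∏ l ∈ Finset.univ.erase j, (μ i - μ l)) =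
      Matrix.diagonal fun i => ∏ l ∈ Finset.univ.erase i, (μ i - μ l) := by
    ext i j
    by_cases h : i = j
    · subst h; simp
    · rw [Matrix.diagonal_apply_ne _ h, Matrix.of_apply]
      exact Finset.prod_eq_zero (i := i) (by simp [h]) (sub_self _)
  have h1 := congrArg (fun M => |M.det|) (key μ)
  simp only [hd, det_diagonal, abs_prod_prod_erase_sub, det_mul, abs_mul,
    det_vandermonde_eq_vdm, abs_of_pos (vdm_pos hμ)] at h1
  have h2 : |c.det| = vdm μ := by
    have := (vdm_pos hμ).ne'
    apply mul_left_cancel₀ this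
    rw [← h1, sq]
  rw [key q, det_mul, abs_mul, h2, det_vandermonde_eq_vdm]

/-- The open set of tuples that interlace with `q`, from above. -/
def interlacing {m : ℕ} (q : Fin (m + 1) → ℝ) : Set (Fin (m + 1) → ℝ) :=
  {μ | (∀ i, q i < μ i) ∧ ∀ i : Fin m, μ i.castSucc < q i.succ}

theorem isOpen_interlacing {m : ℕ} (q : Fin (m + 1) → ℝ) : IsOpen (interlacing q) := by
  have : interlacing q = (⋂ i, {μ | q i < μ i}) ∩ ⋂ i : Fin m, {μ | μ i.castSucc < q i.succ} := by
    ext; simp [interlacing]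
  rw [this]
  refine IsOpen.inter (isOpen_iInter_of_finite fun i => ?_) (isOpen_iInter_of_finite fun i => ?_)
  · exact isOpen_lt continuous_const (continuous_apply _)
  · exact isOpen_lt (continuous_apply _) continuous_const

theorem interlacing.strictMono {m : ℕ} {q μ : Fin (m + 1) → ℝ} (h : μ ∈ interlacing q) :
    StrictMono μ :=
  Fin.strictMono_iff_lt_succ.2 fun i => (h.2 i).trans (h.1 _)

theorem interlacing.lt_of_lt {m : ℕ} {q μ : Fin (m + 1) → ℝ} (hq : StrictMono q)
    (h : μ ∈ interlacing q) {i j : Fin (m + 1)} (hij : j < i) : μ j < q i := by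
  obtain ⟨j', rfl⟩ := Fin.exists_castSucc_eq.2 (Fin.ne_last_of_lt hij)
  exact (h.2 j').trans_le (hq.monotone (Fin.castSucc_lt_iff_succ_le.1 hij))

/-- The squared moduli of the rank one perturbation of `diag q` having the spectrum `μ`. -/
def weights {m : ℕ} (q μ : Fin (m + 1) → ℝ) (i : Fin (m + 1)) : ℝ :=
  -(∏ j, (q i - μ j)) / ∏ j ∈ Finset.univ.erase i, (q i - q j)

theorem weights_pos {m : ℕ} {q μ : Fin (m + 1) → ℝ} (hq : StrictMono q)
    (h : μ ∈ interlacing q) (i : Fin (m + 1)) : 0 < weights q μ i := by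
  rw [weights, ← Finset.mul_prod_erase _ _ (Finset.mem_univ i), ← neg_mul, mul_div_assoc,
    ← Finset.prod_div_distrib]
  refine mul_pos (by linarith [h.1 i]) (Finset.prod_pos fun j hj => ?_)
  rcases lt_or_gt_of_ne (Finset.ne_of_mem_erase hj) with hlt | hgt
  · exact div_pos (sub_pos.2 (interlacing.lt_of_lt hq h hlt)) (sub_pos.2 (hq hlt))
  · exact div_pos_of_neg_of_neg (sub_neg.2 ((hq hgt).trans (h.1 j))) (sub_neg.2 (hq hgt))

theorem prod_erase_sub_ne_zero {m : ℕ} {q : Fin m → ℝ} (hq : StrictMono q) (i : Fin m) :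
    ∏ j ∈ Finset.univ.erase i, (q i - q j) ≠ 0 :=
  Finset.prod_ne_zero_iff.2 fun _ hj =>
    sub_ne_zero.2 (hq.injective.ne (Finset.ne_of_mem_erase hj).symm)

open Polynomial in
/-- The characteristic polynomial of a rank one perturbation of `diag q`
with squared moduli `τ`. -/
def secular {m : ℕ} (q τ : Fin m → ℝ) : ℝ[X] :=
  ∏ i, (X - C (q i)) - ∑ i, C (τ i) * ∏ l ∈ Finset.univ.erase i, (X - C (q l))

open Polynomial in
theorem degree_secular_sub {m : ℕ} (q τ : Fin (m + 1) → ℝ) :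
    degree (∑ i, C (τ i) * ∏ l ∈ Finset.univ.erase i, (X - C (q l))) <
      degree (∏ i, (X - C (q i))) := by
  have h1 : degree (∏ i, (X - C (q i))) = (m + 1 : ℕ) := by
    rw [degree_prod]; simp
  rw [h1]
  refine (degree_sum_le _ _).trans_lt ((Finset.sup_lt_iff ?_).2 fun i _ => ?_)
  · exact WithBot.bot_lt_coe _
  · refine (degree_mul_le _ _).trans_lt ((add_le_add_left degree_C_le _).trans_lt ?_)
    rw [degree_prod]
    simp only [degree_X_sub_C, Finset.sum_const, Finset.card_erase_of_mem (Finset.mem_univ i),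
      Finset.card_univ, Fintype.card_fin]
    simp
    exact_mod_cast Nat.lt_succ_self m

open Polynomial in
theorem secular_monic {m : ℕ} (q τ : Fin (m + 1) → ℝ) : (secular q τ).Monic :=
  (monic_prod_of_monic _ _ fun _ _ => monic_X_sub_C _).sub_of_left (degree_secular_sub q τ)

open Polynomial in
theorem natDegree_secular {m : ℕ} (q τ : Fin (m + 1) → ℝ) :
    (secular q τ).natDegree = m + 1 := by
  have h : (secular q τ).degree = (m + 1 : ℕ) := by
    rw [secular, degree_sub_eq_left_of_degree_lt (degree_secular_sub q τ), degree_prod]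
    simp
  exact natDegree_eq_of_degree_eq_some h

open Polynomial in
theorem eval_secular {m : ℕ} (q τ : Fin m → ℝ) (i : Fin m) :
    (secular q τ).eval (q i) = -(τ i * ∏ l ∈ Finset.univ.erase i, (q i - q l)) := by
  simp only [secular, eval_sub, eval_prod, eval_X, eval_C, eval_finsetSum, eval_mul]
  rw [Finset.prod_eq_zero (Finset.mem_univ i) (sub_self _), zero_sub,
    Finset.sum_eq_single i _ (by simp)]
  intro j _ hj
  rw [Finset.prod_eq_zero (i := i) (by simp [hj.symm]) (sub_self _), mul_zero]

open Polynomial in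
theorem secular_eq_prod_iff {m : ℕ} {q : Fin (m + 1) → ℝ} (hq : StrictMono q)
    (τ μ : Fin (m + 1) → ℝ) : secular q τ = ∏ i, (X - C (μ i)) ↔ weights q μ = τ := by
  constructor
  · intro h
    ext i
    have := eval_secular q τ i
    rw [h, eval_prod] at this
    simp only [eval_sub, eval_X, eval_C] at this
    rw [weights, this, neg_neg, mul_div_cancel_right₀ _ (prod_erase_sub_ne_zero hq i)]
  · rintro rfl
    refine monic_eq_of_eval_eq (secular_monic _ _)
      (monic_prod_of_monic _ _ fun _ _ => monic_X_sub_C _) (natDegree_secular _ _) ?_ q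
      hq.injective fun i => ?_
    · rw [natDegree_prod_of_monic _ _ fun _ _ => monic_X_sub_C _]; simp
    · rw [eval_secular, weights, div_mul_cancel₀ _ (prod_erase_sub_ne_zero hq i), neg_neg,
        eval_prod]
      simp

theorem weights_injOn {m : ℕ} {q : Fin (m + 1) → ℝ} (hq : StrictMono q) :
    Set.InjOn (weights q) (interlacing q) := fun _ hμ _ hμ' h =>
  eq_of_prod_X_sub_C_eq (interlacing.strictMono hμ).monotone
    (interlacing.strictMono hμ').monotone <|
    ((secular_eq_prod_iff hq _ _).2 rfl).symm.trans ((secular_eq_prod_iff hq _ _).2 h.symm)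

open Polynomial in
theorem exists_weights_eq {m : ℕ} {q τ : Fin (m + 1) → ℝ} (hq : StrictMono q)
    (hτ : ∀ i, 0 < τ i) : ∃ μ ∈ interlacing q, weights q μ = τ := by
  set R := secular q τ with hR
  have hcont : ∀ s : Set ℝ, ContinuousOn (fun x => R.eval x) s := fun s =>
    R.continuous.continuousOn
  have hsign : ∀ i : Fin m, R.eval (q i.castSucc) * R.eval (q i.succ) < 0 := by
    intro i
    have hlt : q i.castSucc < q i.succ := hq Fin.castSucc_lt_succ
    have hne : i.castSucc ≠ i.succ := Fin.castSucc_lt_succ.ne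
    rw [hR, eval_secular, eval_secular,
      ← Finset.mul_prod_erase (Finset.univ.erase i.castSucc) _
        (Finset.mem_erase.2 ⟨hne.symm, Finset.mem_univ i.succ⟩),
      ← Finset.mul_prod_erase (Finset.univ.erase i.succ) _
        (Finset.mem_erase.2 ⟨hne, Finset.mem_univ i.castSucc⟩), Finset.erase_right_comm]
    have hpos : 0 < (∏ x ∈ (Finset.univ.erase i.succ).erase i.castSucc, (q i.castSucc - q x)) *
        ∏ x ∈ (Finset.univ.erase i.succ).erase i.castSucc, (q i.succ - q x) := by
      rw [← Finset.prod_mul_distrib]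
      refine Finset.prod_pos fun x hx => ?_
      simp only [Finset.mem_erase, Finset.mem_univ, and_true] at hx
      rcases lt_or_gt_of_ne hx.1 with h | h
      · exact mul_pos (sub_pos.2 (hq h)) (sub_pos.2 ((hq h).trans hlt))
      · have h' : i.succ < x := lt_of_le_of_ne (Fin.castSucc_lt_iff_succ_le.1 h) hx.2.symm
        exact mul_pos_of_neg_of_neg (sub_neg.2 (hq h)) (sub_neg.2 (hq h'))
    have := mul_pos (mul_pos (hτ i.castSucc) (hτ i.succ)) (mul_pos hpos
      (mul_pos (sub_pos.2 hlt) (sub_pos.2 hlt)))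
    nlinarith [this]
  have hroot : ∀ i : Fin m, ∃ x ∈ Set.Ioo (q i.castSucc) (q i.succ), R.eval x = 0 := by
    intro i
    have hlt : q i.castSucc < q i.succ := hq Fin.castSucc_lt_succ
    rcases mul_neg_iff.1 (hsign i) with ⟨h1, h2⟩ | ⟨h1, h2⟩
    · exact intermediate_value_Ioo' hlt.le (hcont _) ⟨h2, h1⟩
    · exact intermediate_value_Ioo hlt.le (hcont _) ⟨h1, h2⟩
  have hlast : ∃ x, q (Fin.last m) < x ∧ R.eval x = 0 := by
    have hneg : R.eval (q (Fin.last m)) < 0 := by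
      rw [hR, eval_secular]
      refine neg_neg_of_pos (mul_pos (hτ _) (Finset.prod_pos fun j hj => sub_pos.2 (hq ?_)))
      exact lt_of_le_of_ne (Fin.le_last _) (Finset.ne_of_mem_erase hj)
    have htend := R.tendsto_atTop_of_leadingCoeff_nonneg
      (natDegree_pos_iff_degree_pos.1 (by rw [natDegree_secular]; omega))
      (by rw [(secular_monic q τ).leadingCoeff]; exact zero_le_one)
    obtain ⟨y, hy1, hy2⟩ := ((htend.eventually_gt_atTop 0).and
      (Filter.eventually_gt_atTop (q (Fin.last m)))).exists
    obtain ⟨x, hx, hx0⟩ := intermediate_value_Ioo hy2.le (hcont _) ⟨hneg, hy1⟩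
    exact ⟨x, hx.1, hx0⟩
  choose ν hν hν0 using hroot
  obtain ⟨y, hy, hy0⟩ := hlast
  refine ⟨Fin.snoc ν y, ?_, ?_⟩
  · refine ⟨fun i => ?_, fun i => ?_⟩
    · refine Fin.lastCases ?_ (fun j => ?_) i
      · simpa using hy
      · simpa using (hν j).1
    · simpa using (hν i).2
  · have hmem : (Fin.snoc ν y : Fin (m + 1) → ℝ) ∈ interlacing q := by
      refine ⟨fun i => ?_, fun i => ?_⟩
      · refine Fin.lastCases ?_ (fun j => ?_) i
        · simpa using hy
        · simpa using (hν j).1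
      · simpa using (hν i).2
    rw [← secular_eq_prod_iff hq]
    refine monic_eq_of_eval_eq (secular_monic _ _)
      (monic_prod_of_monic _ _ fun _ _ => monic_X_sub_C _) (natDegree_secular _ _) ?_ _
      (interlacing.strictMono hmem).injective fun i => ?_
    · rw [natDegree_prod_of_monic _ _ fun _ _ => monic_X_sub_C _]; simp
    · rw [eval_prod, Finset.prod_eq_zero (Finset.mem_univ i) (by simp)]
      refine Fin.lastCases ?_ (fun j => ?_) i
      · simpa using hy0
      · simpa using hν0 j

theorem weights_image {m : ℕ} {q : Fin (m + 1) → ℝ} (hq : StrictMono q) :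
    weights q '' interlacing q = Set.univ.pi fun _ => Set.Ioi 0 := by
  ext τ
  simp only [Set.mem_image, Set.mem_pi, Set.mem_univ, true_imp_iff, Set.mem_Ioi]
  constructor
  · rintro ⟨μ, hμ, rfl⟩
    exact weights_pos hq hμ
  · exact exists_weights_eq hq

theorem hasFDerivAt_weights {m : ℕ} (q μ : Fin (m + 1) → ℝ) :
    HasFDerivAt (weights q) (LinearMap.toContinuousLinearMap (Matrix.toLin' (Matrix.of fun i j =>
      (∏ l ∈ Finset.univ.erase i, (q i - q l))⁻¹ * ∏ l ∈ Finset.univ.erase j, (q i - μ l)))) μ := by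
  rw [hasFDerivAt_pi']
  intro i
  have h := HasFDerivAt.finsetProd (u := Finset.univ) (x := μ)
    (g := fun j (μ : Fin (m + 1) → ℝ) => q i - μ j)
    (g' := fun j => -(ContinuousLinearMap.proj j : (Fin (m + 1) → ℝ) →L[ℝ] ℝ))
    (fun j _ => (hasFDerivAt_apply j μ).const_sub (q i))
  have h2 := (h.neg.mul_const ((∏ l ∈ Finset.univ.erase i, (q i - q l))⁻¹))
  refine (h2.congr_fderiv ?_).congr_of_eventuallyEq (Filter.Eventually.of_forall fun x => ?_)
  · ext v
    simp [Matrix.mulVec, dotProduct, Finset.mul_sum, mul_assoc]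
  · simp [weights, div_eq_mul_inv]

theorem abs_det_fderiv_weights {m : ℕ} {q μ : Fin (m + 1) → ℝ} (hq : StrictMono q)
    (hμ : StrictMono μ) :
    |(LinearMap.toContinuousLinearMap (Matrix.toLin' (Matrix.of fun i j =>
      (∏ l ∈ Finset.univ.erase i, (q i - q l))⁻¹ *
        ∏ l ∈ Finset.univ.erase j, (q i - μ l)))).det| = vdm μ / vdm q := by
  rw [LinearMap.det_toContinuousLinearMap, LinearMap.det_toLin']
  have : (Matrix.of fun i j => (∏ l ∈ Finset.univ.erase i, (q i - q l))⁻¹ *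
        ∏ l ∈ Finset.univ.erase j, (q i - μ l)) =
      Matrix.diagonal (fun i => (∏ l ∈ Finset.univ.erase i, (q i - q l))⁻¹) *
        Matrix.of fun i j => ∏ l ∈ Finset.univ.erase j, (q i - μ l) := by
    ext i j; simp [Matrix.diagonal_mul]
  rw [this, det_mul, det_diagonal, abs_mul, abs_det_prod_erase_sub q μ hμ, Finset.prod_inv_distrib,
    abs_inv, abs_prod_prod_erase_sub, abs_of_pos (vdm_pos hq)]
  have := (vdm_pos hq).ne'
  field_simp

theorem lintegral_orthant_eq {m : ℕ} {q : Fin (m + 1) → ℝ} (hq : StrictMono q)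
    (G : (Fin (m + 1) → ℝ) → ENNReal) :
    ∫⁻ τ in Set.univ.pi fun _ => Set.Ioi 0, G τ =
      ∫⁻ μ in interlacing q, ENNReal.ofReal (vdm μ / vdm q) * G (weights q μ) := by
  rw [← weights_image hq, lintegral_image_eq_lintegral_abs_det_fderiv_mul volume
    (isOpen_interlacing q).measurableSet
    (fun μ _ => (hasFDerivAt_weights q μ).hasFDerivWithinAt) (weights_injOn hq)]
  refine setLIntegral_congr_fun (isOpen_interlacing q).measurableSet fun μ hμ => ?_
  rw [abs_det_fderiv_weights hq (interlacing.strictMono hμ)]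

/-- The box of tuples that interlace with `μ` from the inside. -/
def gaps {m : ℕ} (μ : Fin (m + 1) → ℝ) : Set (Fin m → ℝ) :=
  Set.univ.pi fun i => Set.Ioo (μ i.castSucc) (μ i.succ)

theorem integral_gaps_vdm {m : ℕ} {μ : Fin (m + 1) → ℝ} (hμ : StrictMono μ) :
    ∫ p in gaps μ, vdm p = (∏ j : Fin m, ((j : ℝ) + 1)⁻¹) * vdm μ := by
  have h1 : ∀ p : Fin m → ℝ, vdm p =
      ∑ σ : Equiv.Perm (Fin m), (Equiv.Perm.sign σ : ℝ) * ∏ i, p i ^ (σ i : ℕ) := by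
    intro p
    rw [← det_vandermonde_eq_vdm, ← det_transpose, det_apply']
    simp [vandermonde_apply]
  have h_int : ∀ σ : Equiv.Perm (Fin m),
      ∫ p in gaps μ, ∏ i, p i ^ (σ i : ℕ) =
        ∏ i, ((σ i : ℕ) + 1 : ℝ)⁻¹ *
          (μ i.succ ^ ((σ i : ℕ) + 1) - μ i.castSucc ^ ((σ i : ℕ) + 1)) := by
    intro σ
    rw [gaps, volume_pi, Measure.restrict_pi_pi,
      integral_fintype_prod_eq_prod (fun i (x : ℝ) => x ^ (σ i : ℕ))]
    refine Finset.prod_congr rfl fun i _ => ?_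
    rw [← integral_Ioc_eq_integral_Ioo,
      ← intervalIntegral.integral_of_le (hμ Fin.castSucc_lt_succ).le, integral_pow]
    ring
  have hbdd : gaps μ ⊆ Set.Icc (fun i => μ i.castSucc) (fun i => μ i.succ) := by
    intro p hp
    exact ⟨fun i => (hp i trivial).1.le, fun i => (hp i trivial).2.le⟩
  have hintegrable : ∀ f : (Fin m → ℝ) → ℝ, Continuous f → IntegrableOn f (gaps μ) := fun f hf =>
    (hf.continuousOn.integrableOn_compact isCompact_Icc).mono_set hbdd
  simp_rw [h1]
  rw [integral_finsetSum]
  swap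
  · intro σ _
    exact hintegrable _ (by fun_prop)
  simp_rw [integral_const_mul, h_int]
  rw [← det_vandermonde_eq_vdm μ]
  let B : Matrix (Fin (m + 1)) (Fin (m + 1)) ℝ :=
    Matrix.of fun i j => Fin.cases (μ 0 ^ (j : ℕ))
      (fun i' => μ i'.succ ^ (j : ℕ) - μ i'.castSucc ^ (j : ℕ)) i
  have hB : (vandermonde μ).det = B.det := by
    refine det_eq_of_forall_row_eq_smul_add_pred (fun _ => 1) (fun j => ?_) (fun i j => ?_)
    · simp [B, vandermonde_apply]
    · simp [B, vandermonde_apply]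
  have hB2 : B.det = (Matrix.of fun i j : Fin m =>
      μ i.succ ^ ((j : ℕ) + 1) - μ i.castSucc ^ ((j : ℕ) + 1)).det := by
    rw [det_succ_column_zero, Fin.sum_univ_succ, Finset.sum_eq_zero]
    · simp [B, Matrix.submatrix]
    · intro i _
      simp [B]
  rw [hB, hB2, ← det_transpose, det_apply', Finset.mul_sum]
  refine Finset.sum_congr rfl fun σ _ => ?_
  rw [Finset.prod_mul_distrib, Equiv.prod_comp σ (fun j : Fin m => ((j : ℝ) + 1)⁻¹)]
  simp
  ring

theorem lintegral_gaps_vdm {m : ℕ} {μ : Fin (m + 1) → ℝ} (hμ : StrictMono μ) :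
    ∫⁻ p in gaps μ, ENNReal.ofReal (vdm p) =
      ENNReal.ofReal (∏ j : Fin m, ((j : ℝ) + 1)⁻¹) * ENNReal.ofReal (vdm μ) := by
  have hmeas : MeasurableSet (gaps μ) := MeasurableSet.univ_pi fun _ => measurableSet_Ioo
  have hbdd : gaps μ ⊆ Set.Icc (fun i => μ i.castSucc) (fun i => μ i.succ) := by
    intro p hp
    exact ⟨fun i => (hp i trivial).1.le, fun i => (hp i trivial).2.le⟩
  rw [← ENNReal.ofReal_mul (by positivity), ← integral_gaps_vdm hμ,
    ofReal_integral_eq_lintegral_ofReal]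
  · exact (continuous_vdm.continuousOn.integrableOn_compact isCompact_Icc).mono_set hbdd
  · refine (ae_restrict_iff' hmeas).2 (Filter.Eventually.of_forall fun p hp => ?_)
    refine Finset.prod_nonneg fun i _ => Finset.prod_nonneg fun j hj => sub_nonneg.2 ?_
    have hij : i.succ ≤ j.castSucc := by
      have := Finset.mem_Ioi.1 hj
      simp only [Fin.le_def, Fin.lt_def, Fin.val_succ, Fin.val_castSucc] at this ⊢
      omega
    exact ((hp i trivial).2.le.trans ((hμ.monotone hij).trans (hp j trivial).1.le))

/-- The squares of the singular values of `A`, in increasing order. -/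
def singSq {m : ℕ} {κ : Type*} [Fintype κ] (A : Fin m → κ → ℂ) (i : Fin m) : ℝ :=
  (isHermitian_mul_conjTranspose_self (Matrix.of A)).eigenvalues₀
    (Fin.cast (Fintype.card_fin m).symm i.rev)

section singSq

variable {m : ℕ} {κ : Type*} [Fintype κ]

theorem exists_eigenvalues_eq_singSq (A : Fin m → κ → ℂ) : ∃ σ : Equiv.Perm (Fin m),
    (isHermitian_mul_conjTranspose_self (Matrix.of A)).eigenvalues = singSq A ∘ σ := by
  refine ⟨((Fintype.equivOfCardEq (Fintype.card_fin _)).symm.trans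
    (finCongr (Fintype.card_fin m))).trans Fin.revPerm, ?_⟩
  ext i
  simp [singSq, Matrix.IsHermitian.eigenvalues]

theorem monotone_singSq (A : Fin m → κ → ℂ) : Monotone (singSq A) := fun i j h =>
  (isHermitian_mul_conjTranspose_self (Matrix.of A)).eigenvalues₀_antitone (by simpa using h)

open Polynomial in
theorem charpoly_eq_prod_singSq (A : Fin m → κ → ℂ) :
    (Matrix.of A * (Matrix.of A)ᴴ).charpoly =
      (∏ i, (X - C (singSq A i))).map Complex.ofRealHom := by
  obtain ⟨σ, hσ⟩ := exists_eigenvalues_eq_singSq A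
  rw [(isHermitian_mul_conjTranspose_self (Matrix.of A)).charpoly_eq, hσ, Polynomial.map_prod]
  refine (Equiv.prod_comp σ fun i => X - C ((singSq A i : ℝ) : ℂ)).trans ?_
  simp

open Polynomial in
theorem singSq_eq_of_charpoly_eq {A : Fin m → κ → ℂ} {μ : Fin m → ℝ} (hμ : Monotone μ)
    (h : (Matrix.of A * (Matrix.of A)ᴴ).charpoly =
      (∏ i, (X - C (μ i))).map Complex.ofRealHom) : singSq A = μ := by
  refine eq_of_prod_X_sub_C_eq (monotone_singSq A) hμ
    (Polynomial.map_injective Complex.ofRealHom Complex.ofRealHom.injective ?_)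
  rw [← h, charpoly_eq_prod_singSq]

theorem singSq_eq_singSq {κ' : Type*} [Fintype κ'] {A : Fin m → κ → ℂ} {A' : Fin m → κ' → ℂ}
    (h : (Matrix.of A * (Matrix.of A)ᴴ).charpoly = (Matrix.of A' * (Matrix.of A')ᴴ).charpoly) :
    singSq A = singSq A' :=
  singSq_eq_of_charpoly_eq (monotone_singSq _) (h.trans (charpoly_eq_prod_singSq A'))

theorem sum_singSq (A : Fin m → κ → ℂ) : ∑ i, singSq A i = ∑ i, ∑ k, ‖A i k‖ ^ 2 := by
  obtain ⟨σ, hσ⟩ := exists_eigenvalues_eq_singSq A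
  have h := (isHermitian_mul_conjTranspose_self (Matrix.of A)).trace_eq_sum_eigenvalues
  rw [hσ] at h
  replace h := h.trans (Equiv.sum_comp σ fun i => ((singSq A i : ℝ) : ℂ))
  have h2 : (Matrix.of A * (Matrix.of A)ᴴ).trace = ((∑ i, ∑ k, ‖A i k‖ ^ 2 : ℝ) : ℂ) := by
    simp [Matrix.trace, Matrix.mul_apply, Complex.mul_conj, Complex.normSq_eq_norm_sq]
  rw [h2] at h
  exact_mod_cast h.symm

open Polynomial in
theorem measurable_singSq : Measurable (singSq : (Fin m → κ → ℂ) → Fin m → ℝ) := by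
  let s : Set (Fin m → ℝ) := {p | Monotone p}
  have hs : MeasurableSet s := by
    refine IsClosed.measurableSet ?_
    have : s = ⋂ i, ⋂ j, ⋂ _ : i ≤ j, {p : Fin m → ℝ | p i ≤ p j} := by
      ext; simp [s, Monotone]
    rw [this]
    exact isClosed_iInter fun i => isClosed_iInter fun j => isClosed_iInter fun _ =>
      isClosed_le (continuous_apply i) (continuous_apply j)
  let f : (Fin m → ℝ) → ℕ → ℝ := fun p N => ∏ i, ((N : ℝ) - p i)
  have hf : Continuous f := by fun_prop
  have hinj : Set.InjOn f s := by
    intro p hp r hr h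
    refine eq_of_prod_X_sub_C_eq hp hr (Polynomial.eq_of_infinite_eval_eq _ _ ?_)
    refine (Set.infinite_range_of_injective (Nat.cast_injective (R := ℝ))).mono ?_
    rintro _ ⟨N, rfl⟩
    have := congrFun h N
    simpa [f, eval_prod] using this
  have hemb := ContinuousOn.measurableEmbedding hs hf.continuousOn hinj
  have hmeas : Measurable fun A : Fin m → κ → ℂ => (⟨singSq A, monotone_singSq A⟩ : s) := by
    rw [← hemb.measurable_comp_iff]
    have : ((s.domRestrict f) ∘ fun A : Fin m → κ → ℂ => (⟨singSq A, monotone_singSq A⟩ : s)) =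
        fun A N => (((scalar (Fin m)) (N : ℂ) - Matrix.of A * (Matrix.of A)ᴴ).det).re := by
      ext A N
      have h := congrArg (Polynomial.eval (N : ℂ)) (charpoly_eq_prod_singSq A)
      rw [eval_charpoly] at h
      rw [h]
      have h2 := Polynomial.eval_natCast_map Complex.ofRealHom (∏ i, (X - C (singSq A i))) N
      rw [h2, eval_prod]
      simp only [Function.comp_apply, Set.domRestrict_apply, f, eval_sub, eval_X, eval_C]
      exact (Complex.ofReal_re _).symm
    rw [this]
    refine Continuous.measurable ?_
    refine continuous_pi fun N => Complex.continuous_re.comp (Continuous.matrix_det ?_)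
    refine continuous_const.sub ?_
    have h1 : Continuous fun A : Fin m → κ → ℂ => Matrix.of A := continuous_id
    exact h1.matrix_mul h1.matrix_conjTranspose
  exact measurable_subtype_coe.comp hmeas

theorem exists_unitary_diagonalization (A : Fin m → κ → ℂ) :
    ∃ U : Matrix (Fin m) (Fin m) ℂ, U * Uᴴ = 1 ∧ Uᴴ * U = 1 ∧
      Matrix.of A * (Matrix.of A)ᴴ = U * diagonal (fun i => (singSq A i : ℂ)) * Uᴴ := by
  obtain ⟨σ, hσ⟩ := exists_eigenvalues_eq_singSq A
  set hA := isHermitian_mul_conjTranspose_self (Matrix.of A)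
  set V : Matrix (Fin m) (Fin m) ℂ := hA.eigenvectorUnitary.1
  have h1 : V * Vᴴ = 1 := (Matrix.mem_unitaryGroup_iff).1 hA.eigenvectorUnitary.2
  have h2 : Vᴴ * V = 1 := (Matrix.mem_unitaryGroup_iff').1 hA.eigenvectorUnitary.2
  have h3 : Matrix.of A * (Matrix.of A)ᴴ = V * diagonal (fun i => (singSq A (σ i) : ℂ)) * Vᴴ := by
    have := hA.spectral_theorem
    rw [Unitary.conjStarAlgAut_apply, hσ] at this
    exact this
  have hd : diagonal (fun i => (singSq A i : ℂ)) =
      (diagonal fun i => (singSq A (σ i) : ℂ)).submatrix σ.symm σ.symm := by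
    rw [submatrix_diagonal_equiv]; congr 1; ext i; simp
  refine ⟨V.submatrix id σ.symm, ?_, ?_, ?_⟩
  · rw [conjTranspose_submatrix, submatrix_mul_equiv, h1]; simp
  · rw [conjTranspose_submatrix, ← submatrix_mul _ _ _ _ _ Function.bijective_id, h2]; simp
  · rw [hd, conjTranspose_submatrix, submatrix_mul_equiv, submatrix_mul_equiv, h3]; simp

end singSq

/-- The determinant of a bordered Hermitian matrix, in terms of a diagonalization of its corner. -/
theorem det_bordered {m : ℕ} {U : Matrix (Fin m) (Fin m) ℂ} (h1 : U * Uᴴ = 1) (h2 : Uᴴ * U = 1)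
    (p : Fin m → ℂ) (z y : Fin m → ℂ) (x s : ℂ) (hx : ∀ i, x ≠ p i) :
    (fromBlocks (Matrix.of fun _ _ : Unit => x - s) (-(replicateRow Unit z * Uᴴ))
      (-(U * replicateCol Unit y)) (scalar (Fin m) x - U * diagonal p * Uᴴ)).det =
      (∏ i, (x - p i)) * (x - s - ∑ i, z i * y i / (x - p i)) := by
  have hD : scalar (Fin m) x - U * diagonal p * Uᴴ = U * diagonal (fun i => x - p i) * Uᴴ := by
    have : diagonal (fun i => x - p i) = scalar (Fin m) x - diagonal p := by
      ext i j; by_cases h : i = j <;> simp [h, scalar_apply]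
    rw [this, mul_sub, sub_mul, ← (scalar_commute x (fun _ => Commute.all _ _) U).eq,
      mul_assoc (scalar _ x) U Uᴴ, h1, mul_one]
  have hinv : U * diagonal (fun i => x - p i) * Uᴴ *
      (U * diagonal (fun i => (x - p i)⁻¹) * Uᴴ) = 1 := by
    have : U * diagonal (fun i => x - p i) * Uᴴ * (U * diagonal (fun i => (x - p i)⁻¹) * Uᴴ) =
        U * (diagonal (fun i => x - p i) * (Uᴴ * U) * diagonal (fun i => (x - p i)⁻¹)) * Uᴴ := by
      simp only [mul_assoc]
    rw [this, h2, mul_one, diagonal_mul_diagonal]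
    have h3 : (fun i => (x - p i) * (x - p i)⁻¹) = fun _ => (1 : ℂ) := by
      ext i; exact mul_inv_cancel₀ (sub_ne_zero.2 (hx i))
    rw [h3, diagonal_one, mul_one, h1]
  let _ : Invertible (scalar (Fin m) x - U * diagonal p * Uᴴ) :=
    invertibleOfRightInverse _ (U * diagonal (fun i => (x - p i)⁻¹) * Uᴴ) (by rw [hD, hinv])
  rw [det_fromBlocks₂₂]
  have hI : ⅟(scalar (Fin m) x - U * diagonal p * Uᴴ) =
    U * diagonal (fun i => (x - p i)⁻¹) * Uᴴ := rfl
  rw [hI]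
  have hmid : -(replicateRow Unit z * Uᴴ) * (U * diagonal (fun i => (x - p i)⁻¹) * Uᴴ) *
      -(U * replicateCol Unit y) =
      replicateRow Unit z * diagonal (fun i => (x - p i)⁻¹) * replicateCol Unit y := by
    simp only [Matrix.neg_mul, Matrix.mul_neg, neg_neg]
    calc _ = replicateRow Unit z * ((Uᴴ * U) * diagonal (fun i => (x - p i)⁻¹) * (Uᴴ * U)) *
          replicateCol Unit y := by simp only [Matrix.mul_assoc]
      _ = _ := by rw [h2, one_mul, mul_one]
  have hU : U.det * Uᴴ.det = 1 := by rw [← det_mul, h1, det_one]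
  rw [hmid, hD, det_mul, det_mul, mul_right_comm U.det, hU, one_mul, det_diagonal, det_unique]
  congr 1
  simp [Matrix.mul_apply, diagonal_apply, div_eq_mul_inv]
  exact Finset.sum_congr rfl fun i _ => by ring

open Polynomial in
theorem eval_map_ofRealHom (P : ℝ[X]) (x : ℝ) :
    (P.map Complex.ofRealHom).eval (x : ℂ) = ((P.eval x : ℝ) : ℂ) := by
  rw [eval_map]
  exact (Polynomial.eval₂_at_apply Complex.ofRealHom x)

theorem eval_secular_of_ne {m : ℕ} (q τ : Fin m → ℝ) {x : ℝ} (hx : ∀ i, x - q i ≠ 0) :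
    (secular q τ).eval x = (∏ i, (x - q i)) * (1 - ∑ i, τ i / (x - q i)) := by
  simp only [secular, Polynomial.eval_sub, Polynomial.eval_prod, Polynomial.eval_X,
    Polynomial.eval_C, Polynomial.eval_finsetSum, Polynomial.eval_mul]
  rw [mul_sub, mul_one, Finset.mul_sum]
  congr 1
  refine Finset.sum_congr rfl fun i hi => ?_
  rw [← Finset.mul_prod_erase _ _ hi]
  field_simp [hx i]

/-- In suitable orthonormal coordinates on the space of rows, the spectrum of `A Aᴴ`, where `A`
arises from `B` by adding a row, is governed by a secular equation. -/
theorem exists_isometry_charpoly_cons {m k : ℕ} {κ : Type*} [Fintype κ]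
    (hκ : Fintype.card κ = m + (k + 1)) {B : Fin m → κ → ℂ} (hB : ∀ i, 0 < singSq B i) :
    ∃ Φ : EuclideanSpace ℂ (Fin m ⊕ Fin (k + 1)) ≃ₗᵢ[ℂ] EuclideanSpace ℂ κ,
      ∀ w, (Matrix.of (Fin.cons (Φ w).ofLp B : Fin (m + 1) → κ → ℂ) *
        (Matrix.of (Fin.cons (Φ w).ofLp B : Fin (m + 1) → κ → ℂ))ᴴ).charpoly =
      (secular (Fin.cons 0 (singSq B) : Fin (m + 1) → ℝ)
        (Fin.cons (∑ j, ‖w (Sum.inr j)‖ ^ 2) fun i => ‖w (Sum.inl i)‖ ^ 2)).map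
          Complex.ofRealHom := by
  classical
  obtain ⟨U, h1, h2, hU⟩ := exists_unitary_diagonalization B
  set p := singSq B with hp
  set C : Matrix (Fin m) κ ℂ := Uᴴ * Matrix.of B with hC
  have hBC : Matrix.of B = U * C := by rw [hC, ← Matrix.mul_assoc, h1, Matrix.one_mul]
  have hCC : C * Cᴴ = diagonal fun i => (p i : ℂ) := by
    rw [hC, conjTranspose_mul, conjTranspose_conjTranspose]
    calc _ = Uᴴ * (Matrix.of B * (Matrix.of B)ᴴ) * U := by simp only [Matrix.mul_assoc]
      _ = (Uᴴ * U) * diagonal (fun i => (p i : ℂ)) * (Uᴴ * U) := by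
        rw [hU]; simp only [Matrix.mul_assoc]
      _ = _ := by rw [h2, Matrix.one_mul, Matrix.mul_one]
  have hs : ∀ i, ((√(p i) : ℝ) : ℂ) ≠ 0 := fun i =>
    Complex.ofReal_ne_zero.2 (Real.sqrt_pos.2 (hB i)).ne'
  have hss : ∀ i, ((√(p i) : ℝ) : ℂ) * ((√(p i) : ℝ) : ℂ) = p i := fun i => by
    rw [← Complex.ofReal_mul, Real.mul_self_sqrt (hB i).le]
  let c : Fin m ⊕ Fin (k + 1) → EuclideanSpace ℂ κ := Sum.elim
    (fun i => WithLp.toLp 2 fun l => C i l / (√(p i) : ℝ)) fun _ => 0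
  have hc : Orthonormal ℂ ((Set.range Sum.inl).domRestrict c) := by
    rw [orthonormal_iff_ite]
    rintro ⟨_, i, rfl⟩ ⟨_, j, rfl⟩
    have h3 := congrFun (congrFun hCC j) i
    simp only [Matrix.mul_apply, conjTranspose_apply, diagonal_apply] at h3
    have h4 : inner ℂ (c (Sum.inl i)) (c (Sum.inl j)) =
        (∑ l, C j l * star (C i l)) / ((√(p i) : ℝ) * (√(p j) : ℝ)) := by
      simp only [c, Sum.elim_inl, EuclideanSpace.inner_eq_star_dotProduct, dotProduct,
        Finset.sum_div, Pi.star_apply, star_div₀]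
      refine Finset.sum_congr rfl fun l _ => ?_
      rw [div_mul_div_comm, mul_comm ((√(p i) : ℝ) : ℂ)]
      congr 2
      exact Complex.conj_ofReal _
    change inner ℂ (c (Sum.inl i)) (c (Sum.inl j)) = _
    rw [h4, h3]
    by_cases hij : i = j
    · subst hij
      simp only [if_true, hss]
      rw [div_self]
      exact Complex.ofReal_ne_zero.2 (hB i).ne'
    · rw [if_neg (Ne.symm hij), zero_div, if_neg]
      exact fun h => hij (Sum.inl_injective (congrArg Subtype.val h))
  obtain ⟨b, hb⟩ := hc.exists_orthonormalBasis_extension_of_card_eq (by simp [hκ])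
  refine ⟨b.repr.symm, fun w => ?_⟩
  set r := b.repr.symm w with hr
  have hrz : ∀ i, ∑ l, r l * star (C i l) = (√(p i) : ℝ) * w (Sum.inl i) := by
    intro i
    have h3 : w (Sum.inl i) = inner ℂ (c (Sum.inl i)) r := by
      rw [← hb _ ⟨i, rfl⟩, ← b.repr_apply_apply, hr, b.repr.apply_symm_apply]
    rw [h3]
    simp only [c, Sum.elim_inl, EuclideanSpace.inner_eq_star_dotProduct, dotProduct,
      Pi.star_apply, star_div₀, Finset.mul_sum]
    refine Finset.sum_congr rfl fun l _ => ?_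
    have : star ((√(p i) : ℝ) : ℂ) = (√(p i) : ℝ) := Complex.conj_ofReal _
    rw [this]
    field_simp [hs i]
  have hrr : ∑ l, r l * star (r l) =
      ((∑ j, ‖w (Sum.inr j)‖ ^ 2 + ∑ i, ‖w (Sum.inl i)‖ ^ 2 : ℝ) : ℂ) := by
    have h3 : ‖r‖ ^ 2 = ‖w‖ ^ 2 := by rw [hr, LinearIsometryEquiv.norm_map]
    rw [EuclideanSpace.norm_sq_eq, EuclideanSpace.norm_sq_eq, Fintype.sum_sum_type, add_comm] at h3
    rw [← h3]
    simp [Complex.mul_conj, Complex.normSq_eq_norm_sq]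
  set A : Matrix (Fin (m + 1)) κ ℂ := Matrix.of (Fin.cons r.ofLp B) with hA
  let z : Fin m → ℂ := fun i => (√(p i) : ℝ) * w (Sum.inl i)
  have hrow : ∀ i, ∑ l, r l * star (B i l) = (replicateRow Unit z * Uᴴ) () i := by
    intro i
    have : ∀ l, B i l = ∑ j, U i j * C j l := fun l => congrFun (congrFun hBC i) l
    simp only [this, star_sum, star_mul', Finset.mul_sum, Matrix.mul_apply, replicateRow_apply,
      conjTranspose_apply, z, ← hrz, Finset.sum_mul]
    rw [Finset.sum_comm]
    exact Finset.sum_congr rfl fun _ _ => Finset.sum_congr rfl fun _ _ => by ring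
  have hcol : ∀ i, ∑ l, B i l * star (r l) = (U * replicateCol Unit (star z)) i () := by
    intro i
    have := congrArg star (hrow i)
    simp only [Matrix.mul_apply, star_sum, star_mul', star_star, replicateRow_apply,
      conjTranspose_apply] at this
    simp only [Matrix.mul_apply, replicateCol_apply, Pi.star_apply]
    rw [Finset.sum_congr rfl fun l _ => mul_comm (B i l) (star (r l)), this]
    exact Finset.sum_congr rfl fun _ _ => mul_comm _ _
  obtain ⟨e, he0, he1⟩ : ∃ e : Unit ⊕ Fin m ≃ Fin (m + 1),
      (∀ i, e (Sum.inl i) = 0) ∧ ∀ i, e (Sum.inr i) = i.succ := by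
    refine ⟨Equiv.ofBijective (Sum.elim (fun _ => 0) Fin.succ) ⟨?_, ?_⟩, fun _ => rfl,
      fun _ => rfl⟩
    · rintro (_ | i) (_ | j) h
      · rfl
      · exact absurd h (Fin.succ_ne_zero j).symm
      · exact absurd h (Fin.succ_ne_zero i)
      · exact congrArg _ (Fin.succ_injective _ h)
    · refine Fin.cases ⟨Sum.inl (), rfl⟩ fun i => ⟨Sum.inr i, rfl⟩
  have hblock : ∀ x : ℂ, (scalar (Fin (m + 1)) x - A * Aᴴ).submatrix e e =
      fromBlocks (Matrix.of fun _ _ : Unit => x - ((∑ j, ‖w (Sum.inr j)‖ ^ 2 +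
        ∑ i, ‖w (Sum.inl i)‖ ^ 2 : ℝ) : ℂ)) (-(replicateRow Unit z * Uᴴ))
      (-(U * replicateCol Unit (star z)))
      (scalar (Fin m) x - U * diagonal (fun i => (p i : ℂ)) * Uᴴ) := by
    intro x
    rw [← hU]
    ext (i | i) (j | j)
    · simp only [submatrix_apply, he0, fromBlocks_apply₁₁, Matrix.sub_apply, scalar_apply,
        diagonal_apply_eq, of_apply, Matrix.mul_apply, conjTranspose_apply, hA, Fin.cons_zero, hrr]
    · simp only [submatrix_apply, he0, he1, fromBlocks_apply₁₂, Matrix.sub_apply, scalar_apply,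
        Matrix.neg_apply, ← hrow, diagonal_apply_ne _ (Fin.succ_ne_zero j).symm, zero_sub]
      rfl
    · simp only [submatrix_apply, he0, he1, fromBlocks_apply₂₁, Matrix.sub_apply, scalar_apply,
        Matrix.neg_apply, ← hcol, diagonal_apply_ne _ (Fin.succ_ne_zero i), zero_sub]
      rfl
    · simp only [submatrix_apply, he1, fromBlocks_apply₂₂, Matrix.sub_apply, scalar_apply,
        of_apply, Matrix.mul_apply, conjTranspose_apply, hA, Fin.cons_succ, diagonal_apply,
        Fin.succ_inj]
  refine monic_eq_of_eval_eq (n := m + 1) (charpoly_monic _) ((secular_monic _ _).map _) ?_ ?_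
    (fun j : Fin (m + 1) => ((-((j : ℝ) + 1) : ℝ) : ℂ)) ?_ ?_
  · rw [charpoly_natDegree_eq_dim, Fintype.card_fin]
  · rw [(secular_monic _ _).natDegree_map, natDegree_secular]
  · intro i j hij
    have : -((i : ℝ) + 1) = -((j : ℝ) + 1) := Complex.ofReal_injective hij
    exact Fin.ext (by exact_mod_cast (by linarith : (i : ℝ) = j))
  · intro j
    set x : ℝ := -((j : ℝ) + 1) with hx
    have hx0 : x < 0 := by have : (0 : ℝ) ≤ j := Nat.cast_nonneg _; linarith
    have hxp : ∀ i, x - p i ≠ 0 := fun i => (by linarith [hB i] : x - p i < 0).ne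
    rw [eval_charpoly, eval_map_ofRealHom, ← det_submatrix_equiv_self e, hblock,
      det_bordered h1 h2 _ _ _ _ _ fun i => by
        exact_mod_cast sub_ne_zero.1 (hxp i)]
    have hz : ∀ i, z i * star z i = ((p i * ‖w (Sum.inl i)‖ ^ 2 : ℝ) : ℂ) := by
      intro i
      have : z i * star z i = z i * (starRingEnd ℂ) (z i) := rfl
      rw [this, Complex.mul_conj, Complex.normSq_eq_norm_sq]
      simp only [z, norm_mul, mul_pow, Complex.norm_real, Real.norm_eq_abs, sq_abs]
      rw [Real.sq_sqrt (hB i).le]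
    simp only [hz]
    norm_cast
    rw [eval_secular_of_ne]
    · rw [Fin.prod_univ_succ (n := m), Fin.sum_univ_succ (n := m)]
      simp only [Fin.cons_zero, Fin.cons_succ, sub_zero]
      have h3 : ∀ i, p i * ‖w (Sum.inl i)‖ ^ 2 / (x - p i) =
          x * (‖w (Sum.inl i)‖ ^ 2 / (x - p i)) - ‖w (Sum.inl i)‖ ^ 2 := fun i => by
        field_simp [hxp i]
        ring
      simp only [h3, Finset.sum_sub_distrib, ← Finset.mul_sum]
      field_simp [hx0.ne]
      ring
    · refine Fin.cases ?_ fun i => ?_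
      · simpa using hx0.ne
      · simpa using hxp i

/-- A function whose sublevel sets have measure `C r ^ (k + 1)` pushes the measure forward to
a multiple of `s ^ k ds`. -/
theorem map_eq_withDensity_pow {E : Type*} [MeasurableSpace E] {ν : Measure E} {f : E → ℝ}
    (hf : Measurable f) {C : ENNReal} (hC : C ≠ ⊤) (k : ℕ)
    (h : ∀ r, ν {x | f x < r} = C * ENNReal.ofReal r ^ (k + 1)) :
    ν.map f = (C * (k + 1)) • (volume.restrict (Set.Ioi 0)).withDensity
      fun s => ENNReal.ofReal (s ^ k) := by
  refine Measure.ext_of_generateFrom_of_iUnion (Set.range Set.Iio) (fun n : ℕ => Set.Iio (n : ℝ))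
    (borel_eq_generateFrom_Iio ℝ ▸ BorelSpace.measurable_eq) isPiSystem_Iio ?_
    (fun n => ⟨n, rfl⟩) ?_ ?_
  · exact Set.eq_univ_of_forall fun x => Set.mem_iUnion.2 (exists_nat_gt x)
  · intro n
    rw [Measure.map_apply hf measurableSet_Iio]
    change ν {x | f x < n} ≠ ⊤
    rw [h]
    exact ENNReal.mul_ne_top hC (by finiteness)
  · rintro _ ⟨r, rfl⟩
    rw [Measure.map_apply hf measurableSet_Iio]
    change ν {x | f x < r} = _
    rw [h, Measure.smul_apply, withDensity_apply _ measurableSet_Iio,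
      Measure.restrict_restrict measurableSet_Iio, smul_eq_mul, mul_assoc]
    congr 1
    rw [Set.inter_comm, Set.Ioi_inter_Iio]
    rcases le_or_gt r 0 with hr | hr
    · simp [Set.Ioo_eq_empty (not_lt.2 hr), ENNReal.ofReal_of_nonpos hr]
    · rw [← ofReal_integral_eq_lintegral_ofReal, ← integral_Ioc_eq_integral_Ioo,
        ← intervalIntegral.integral_of_le hr.le, integral_pow]
      · rw [← ENNReal.ofReal_pow hr.le, zero_pow (Nat.succ_ne_zero k), sub_zero]
        have : ((k : ENNReal) + 1) = ENNReal.ofReal (k + 1) := by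
          rw [ENNReal.ofReal_add (by positivity) zero_le_one]; simp
        rw [this, ← ENNReal.ofReal_mul (by positivity)]
        congr 1
        field_simp
      · exact ((continuous_pow k).integrableOn_Icc (a := 0) (b := r)).mono_set
          Set.Ioo_subset_Icc_self
      · exact (ae_restrict_mem measurableSet_Ioo).mono fun s hs => pow_nonneg hs.1.le k

theorem exists_map_sum_norm_sq (k : ℕ) : ∃ c : ENNReal, c ≠ 0 ∧ c ≠ ⊤ ∧
    (volume : Measure (Fin (k + 1) → ℂ)).map (fun w => ∑ j, ‖w j‖ ^ 2) =
      c • (volume.restrict (Set.Ioi 0)).withDensity fun s => ENNReal.ofReal (s ^ k) := by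
  refine ⟨_, ?_, ?_, map_eq_withDensity_pow (C := ENNReal.ofReal
    ((Real.pi * Real.Gamma (2 / 2 + 1)) ^ Fintype.card (Fin (k + 1)) /
      Real.Gamma (2 * Fintype.card (Fin (k + 1)) / 2 + 1))) (by fun_prop) (by finiteness) k ?_⟩
  · refine mul_ne_zero (ENNReal.ofReal_ne_zero_iff.2 ?_) (by simp)
    exact div_pos (pow_pos (mul_pos Real.pi_pos (Real.Gamma_pos_of_pos (by norm_num))) _)
      (Real.Gamma_pos_of_pos (by positivity))
  · finiteness
  · intro r
    rcases le_or_gt r 0 with hr | hr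
    · have : {w : Fin (k + 1) → ℂ | ∑ j, ‖w j‖ ^ 2 < r} = ∅ :=
        Set.eq_empty_of_forall_notMem fun w hw =>
          (hw.trans_le hr).not_ge (Finset.sum_nonneg fun _ _ => by positivity)
      rw [this, ENNReal.ofReal_of_nonpos hr]
      simp
    · have h := Complex.volume_sum_rpow_lt (Fin (k + 1)) (p := 2) (by norm_num) (√r)
      have hset : {w : Fin (k + 1) → ℂ | (∑ j, ‖w j‖ ^ (2 : ℝ)) ^ (1 / (2 : ℝ)) < √r} =
          {w | ∑ j, ‖w j‖ ^ 2 < r} := by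
        ext w
        simp only [Set.mem_ofPred_eq, Real.rpow_two, ← Real.sqrt_eq_rpow]
        exact Real.sqrt_lt_sqrt_iff (Finset.sum_nonneg fun _ _ => by positivity)
      rw [hset] at h
      rw [h, mul_comm, Fintype.card_fin, pow_mul, ← ENNReal.ofReal_pow (Real.sqrt_nonneg r),
        Real.sq_sqrt hr.le]

theorem exists_map_norm_sq : ∃ c : ENNReal, c ≠ 0 ∧ c ≠ ⊤ ∧
    (volume : Measure ℂ).map (fun w => ‖w‖ ^ 2) = c • volume.restrict (Set.Ioi 0) := by
  obtain ⟨c, h0, h1, h⟩ := exists_map_sum_norm_sq 0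
  refine ⟨c, h0, h1, ?_⟩
  have h2 := (volume_preserving_funUnique (Fin 1) ℂ)
  rw [← h2.map_eq, Measure.map_map (by fun_prop) h2.measurable]
  simp only [Nat.reduceAdd, pow_zero, ENNReal.ofReal_one, ← Pi.one_def, withDensity_one,
    Fin.sum_univ_succ, Finset.univ_eq_empty, Finset.sum_empty, add_zero] at h
  exact h

theorem pi_const_smul {m : ℕ} {c : ENNReal} (hc : c ≠ ⊤) (ρ : Measure ℝ) [SigmaFinite ρ] :
    Measure.pi (fun _ : Fin m => c • ρ) = c ^ m • Measure.pi fun _ : Fin m => ρ := by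
  lift c to NNReal using hc
  have : SigmaFinite ((c : ENNReal) • ρ) := SMul.sigmaFinite c
  refine Measure.pi_eq (μ := fun _ : Fin m => (c : ENNReal) • ρ) fun s _ => ?_
  simp [Measure.pi_pi, Finset.prod_mul_distrib]

theorem exists_map_pi_norm_sq (m : ℕ) : ∃ c : ENNReal, c ≠ 0 ∧ c ≠ ⊤ ∧
    (volume : Measure (Fin m → ℂ)).map (fun u i => ‖u i‖ ^ 2) =
      c • volume.restrict (Set.univ.pi fun _ => Set.Ioi 0) := by
  obtain ⟨c, h0, h1, h⟩ := exists_map_norm_sq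
  refine ⟨c ^ m, pow_ne_zero _ h0, ENNReal.pow_ne_top h1, ?_⟩
  lift c to NNReal using h1
  have hρ : SigmaFinite ((c : ENNReal) • (volume.restrict (Set.Ioi (0 : ℝ)))) := SMul.sigmaFinite c
  have h2 := (measurePreserving_pi (fun _ : Fin m => (volume : Measure ℂ))
    (fun _ : Fin m => (c : ENNReal) • (volume.restrict (Set.Ioi (0 : ℝ))))
    (f := fun _ w => ‖w‖ ^ 2) fun _ => ⟨by fun_prop, h⟩).map_eq
  rw [pi_const_smul ENNReal.coe_ne_top, ← Measure.restrict_pi_pi] at h2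
  exact h2

theorem measurable_finCons {α : Type*} [MeasurableSpace α] {m : ℕ} :
    Measurable fun x : α × (Fin m → α) => (Fin.cons x.1 x.2 : Fin (m + 1) → α) := by
  refine measurable_pi_iff.2 (Fin.cases ?_ fun i => ?_)
  · simpa using measurable_fst
  · exact (measurable_pi_apply i).comp measurable_snd

theorem lintegral_finCons {α : Type*} [MeasureSpace α] [SigmaFinite (volume : Measure α)] {m : ℕ}
    {F : (Fin (m + 1) → α) → ENNReal} (hF : Measurable F) :
    ∫⁻ x, F x = ∫⁻ B : Fin m → α, ∫⁻ r : α, F (Fin.cons r B) := by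
  have h := (volume_preserving_piFinSuccAbove (fun _ : Fin (m + 1) => α) 0).symm
  rw [h.lintegral_map_equiv, Measure.volume_eq_prod, lintegral_prod_symm]
  · simp [MeasurableEquiv.piFinSuccAbove, Fin.consEquiv]
  · exact (hF.comp (MeasurableEquiv.measurable _)).aemeasurable

theorem exists_map_ofLp (ι : Type*) [Fintype ι] : ∃ c : ENNReal, c ≠ 0 ∧ c ≠ ⊤ ∧
    (volume : Measure (EuclideanSpace ℂ ι)).map WithLp.ofLp = c • volume := by
  let L := EuclideanSpace.equiv ι ℂ
  have : (Measure.map L (volume : Measure (EuclideanSpace ℂ ι))).IsAddHaarMeasure :=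
    L.isAddHaarMeasure_map _
  refine ⟨Measure.addHaarScalarFactor
    (Measure.map L (volume : Measure (EuclideanSpace ℂ ι))) volume, ?_, ENNReal.coe_ne_top,
    Measure.isAddLeftInvariant_eq_smul (Measure.map L volume) volume⟩
  exact ENNReal.coe_ne_zero.2 (Measure.addHaarScalarFactor_pos_of_isAddHaarMeasure _ _).ne'

theorem measurable_ofLp' {ι : Type*} [Fintype ι] :
    Measurable (WithLp.ofLp : EuclideanSpace ℂ ι → ι → ℂ) :=
  (EuclideanSpace.equiv ι ℂ).continuous.measurable

theorem measurePreserving_linearIsometryEquiv {ι κ : Type*} [Fintype ι] [Fintype κ]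
    (Φ : EuclideanSpace ℂ ι ≃ₗᵢ[ℂ] EuclideanSpace ℂ κ) :
    MeasurePreserving Φ := by
  let Ψ : EuclideanSpace ℂ ι ≃ₗᵢ[ℝ] EuclideanSpace ℂ κ :=
    { Φ.toLinearEquiv.restrictScalars ℝ with norm_map' := Φ.norm_map }
  exact Ψ.measurePreserving

/-- Integration of a function of the squared coordinates of `u` and of the squared norm
of `v`. -/
theorem exists_lintegral_norm_sq (m k : ℕ) : ∃ c : ENNReal, c ≠ 0 ∧ c ≠ ⊤ ∧
    ∀ G : (Fin (m + 1) → ℝ) → ENNReal, Measurable G →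
      ∫⁻ w : Fin m ⊕ Fin (k + 1) → ℂ,
        G (Fin.cons (∑ j, ‖w (Sum.inr j)‖ ^ 2) fun i => ‖w (Sum.inl i)‖ ^ 2) =
      c * ∫⁻ τ in Set.univ.pi fun _ => Set.Ioi 0, ENNReal.ofReal (τ 0 ^ k) * G τ := by
  obtain ⟨c, hc0, hc1, hc⟩ := exists_map_pi_norm_sq m
  obtain ⟨d, hd0, hd1, hd⟩ := exists_map_sum_norm_sq k
  refine ⟨d * c, mul_ne_zero hd0 hc0, ENNReal.mul_ne_top hd1 hc1, fun G hG => ?_⟩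
  have hG1 : Measurable fun x : ℝ × (Fin m → ℝ) => G (Fin.cons x.1 x.2) :=
    hG.comp measurable_finCons
  have hG2 : Measurable fun x : ℝ × (Fin m → ℝ) =>
      ENNReal.ofReal (x.1 ^ k) * G (Fin.cons x.1 x.2) := by fun_prop
  have h := (volume_measurePreserving_sumPiEquivProdPi
    (fun _ : Fin m ⊕ Fin (k + 1) => ℂ)).symm
  calc _ = ∫⁻ u : Fin m → ℂ, ∫⁻ v : Fin (k + 1) → ℂ,
        G (Fin.cons (∑ j, ‖v j‖ ^ 2) fun i => ‖u i‖ ^ 2) := by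
        rw [h.lintegral_map_equiv, Measure.volume_eq_prod, lintegral_prod]
        · rfl
        · refine (hG1.comp (f := fun x : (Fin m → ℂ) × (Fin (k + 1) → ℂ) =>
            (∑ j, ‖x.2 j‖ ^ 2, fun i => ‖x.1 i‖ ^ 2)) ?_).aemeasurable
          refine Measurable.prodMk (by fun_prop) (by fun_prop)
    _ = ∫⁻ u : Fin m → ℂ, d * ∫⁻ s in Set.Ioi 0, ENNReal.ofReal (s ^ k) *
          G (Fin.cons s fun i => ‖u i‖ ^ 2) := by
        refine lintegral_congr fun u => ?_
        have h1 : Measurable fun s => G (Fin.cons s fun i => ‖u i‖ ^ 2) :=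
          hG1.comp measurable_prodMk_right
        have h2 : Measurable fun v : Fin (k + 1) → ℂ => ∑ j, ‖v j‖ ^ 2 := by fun_prop
        rw [← lintegral_map h1 h2, hd, lintegral_smul_measure,
          lintegral_withDensity_eq_lintegral_mul _ (by fun_prop) h1]
        rfl
    _ = d * c * ∫⁻ t in Set.univ.pi fun _ : Fin m => Set.Ioi (0 : ℝ),
          ∫⁻ s in Set.Ioi 0, ENNReal.ofReal (s ^ k) * G (Fin.cons s t) := by
        have h1 : Measurable fun t : Fin m → ℝ =>
            ∫⁻ s in Set.Ioi 0, ENNReal.ofReal (s ^ k) * G (Fin.cons s t) :=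
          hG2.lintegral_prod_left'
        have h2 : Measurable fun (u : Fin m → ℂ) (i : Fin m) => ‖u i‖ ^ 2 := by fun_prop
        rw [lintegral_const_mul' _ _ hd1, mul_assoc, ← lintegral_map h1 h2, hc,
          lintegral_smul_measure, smul_eq_mul]
    _ = _ := by
        congr 1
        have hs : ∀ n : ℕ, MeasurableSet (Set.univ.pi fun _ : Fin n => Set.Ioi (0 : ℝ)) :=
          fun n => MeasurableSet.univ_pi fun _ => measurableSet_Ioi
        rw [← lintegral_indicator (hs _), ← lintegral_indicator (hs _), lintegral_finCons]
        · refine lintegral_congr fun t => ?_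
          by_cases ht : t ∈ Set.univ.pi fun _ : Fin m => Set.Ioi (0 : ℝ)
          · rw [Set.indicator_of_mem ht, ← lintegral_indicator measurableSet_Ioi]
            refine lintegral_congr fun s => ?_
            classical
            simp only [Set.indicator_apply]
            refine if_congr ?_ rfl rfl
            constructor
            · intro h0 i _
              refine Fin.cases ?_ (fun j => ?_) i
              · simpa using h0
              · simpa using ht j (Set.mem_univ _)
            · intro h0
              simpa using h0 0 (Set.mem_univ _)
          · rw [Set.indicator_of_notMem ht]
            refine (lintegral_eq_zero_of_ae_eq_zero (Filter.Eventually.of_forall fun s => ?_)).symm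
            refine Set.indicator_of_notMem (fun h0 => ht fun i _ => ?_) _
            simpa using h0 i.succ (Set.mem_univ _)
        · exact Measurable.indicator (by fun_prop) (hs _)

/-- The distribution of the squared singular values of a matrix one of whose rows varies. -/
theorem exists_lintegral_singSq_cons {m k : ℕ} {κ : Type*} [Fintype κ]
    (hκ : Fintype.card κ = m + (k + 1)) : ∃ c : ENNReal, c ≠ 0 ∧ c ≠ ⊤ ∧
    ∀ B : Fin m → κ → ℂ, StrictMono (Fin.cons 0 (singSq B) : Fin (m + 1) → ℝ) →
    ∀ F : (Fin (m + 1) → ℝ) → ENNReal, Measurable F →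
      ∫⁻ r : κ → ℂ, F (singSq (Fin.cons r B : Fin (m + 1) → κ → ℂ)) =
      c * ∫⁻ μ in interlacing (Fin.cons 0 (singSq B)),
        ENNReal.ofReal (vdm μ / vdm (Fin.cons 0 (singSq B) : Fin (m + 1) → ℝ)) *
        (ENNReal.ofReal (weights (Fin.cons 0 (singSq B)) μ 0 ^ k) * F μ) := by
  obtain ⟨c₁, hc₁0, hc₁1, hc₁⟩ := exists_map_ofLp κ
  obtain ⟨c₂, hc₂0, hc₂1, hc₂⟩ := exists_map_ofLp (Fin m ⊕ Fin (k + 1))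
  obtain ⟨c₃, hc₃0, hc₃1, hc₃⟩ := exists_lintegral_norm_sq m k
  refine ⟨c₁⁻¹ * (c₂ * c₃), ?_, ?_, fun B hB F hF => ?_⟩
  · simp [hc₁1, hc₂0, hc₃0]
  · exact ENNReal.mul_ne_top (ENNReal.inv_ne_top.2 hc₁0) (ENNReal.mul_ne_top hc₂1 hc₃1)
  have hpos : ∀ i, 0 < singSq B i := fun i => by
    simpa using hB (Fin.succ_pos i)
  obtain ⟨Φ, hΦ⟩ := exists_isometry_charpoly_cons hκ hpos
  have hH : Measurable fun r : κ → ℂ => F (singSq (Fin.cons r B : Fin (m + 1) → κ → ℂ)) :=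
    hF.comp (measurable_singSq.comp (measurable_finCons.comp measurable_prodMk_right))
  let W : (Fin (m + 1) → ℝ) → Fin m ⊕ Fin (k + 1) → ℂ := fun τ =>
    Sum.elim (fun i => (√(τ i.succ) : ℝ)) fun j => if j = 0 then ((√(τ 0) : ℝ) : ℂ) else 0
  have hW : Continuous W := by
    refine continuous_pi fun i => ?_
    rcases i with i | j
    · simp only [W, Sum.elim_inl]; fun_prop
    · simp only [W, Sum.elim_inr]
      split_ifs
      · fun_prop
      · exact continuous_const
  let S : (Fin (m + 1) → ℝ) → Fin (m + 1) → ℝ := fun τ =>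
    singSq (Fin.cons (Φ (WithLp.toLp 2 (W τ))).ofLp B : Fin (m + 1) → κ → ℂ)
  have hS : Measurable S := by
    refine measurable_singSq.comp (measurable_finCons.comp (measurable_prodMk_right.comp ?_))
    refine Continuous.measurable ?_
    exact (PiLp.continuous_ofLp 2 _).comp (Φ.continuous.comp ((PiLp.continuous_toLp 2 _).comp hW))
  have hcharpoly : ∀ τ : Fin (m + 1) → ℝ, (∀ i, 0 ≤ τ i) →
      (Matrix.of (Fin.cons (Φ (WithLp.toLp 2 (W τ))).ofLp B : Fin (m + 1) → κ → ℂ) *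
        (Matrix.of (Fin.cons (Φ (WithLp.toLp 2 (W τ))).ofLp B : Fin (m + 1) → κ → ℂ))ᴴ).charpoly =
      (secular (Fin.cons 0 (singSq B)) τ).map Complex.ofRealHom := by
    intro τ hτ
    rw [hΦ]
    congr 2
    refine funext (Fin.cases ?_ fun i => ?_)
    · simp only [Fin.cons_zero, W, Sum.elim_inr]
      rw [Finset.sum_eq_single 0 (fun j _ hj => by simp [hj]) (by simp)]
      simp [hτ 0]
    · simp [W, hτ i.succ]
  have hSw : ∀ w : Fin m ⊕ Fin (k + 1) → ℂ,
      singSq (Fin.cons (Φ (WithLp.toLp 2 w)).ofLp B : Fin (m + 1) → κ → ℂ) =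
      S (Fin.cons (∑ j, ‖w (Sum.inr j)‖ ^ 2) fun i => ‖w (Sum.inl i)‖ ^ 2) := by
    intro w
    refine singSq_eq_singSq ?_
    rw [hΦ, hcharpoly]
    refine Fin.cases ?_ fun i => ?_
    · simpa using Finset.sum_nonneg fun _ _ => by positivity
    · simp only [Fin.cons_succ]; positivity
  have hSμ : ∀ μ ∈ interlacing (Fin.cons 0 (singSq B) : Fin (m + 1) → ℝ),
      S (weights (Fin.cons 0 (singSq B)) μ) = μ := by
    intro μ hμ
    refine singSq_eq_of_charpoly_eq (interlacing.strictMono hμ).monotone ?_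
    rw [hcharpoly _ fun i => (weights_pos hB hμ i).le, (secular_eq_prod_iff hB _ _).2 rfl]
  calc ∫⁻ r : κ → ℂ, F (singSq (Fin.cons r B : Fin (m + 1) → κ → ℂ))
      = c₁⁻¹ * ∫⁻ v : EuclideanSpace ℂ κ, F (singSq (Fin.cons v.ofLp B : Fin (m + 1) → κ → ℂ)) := by
        rw [← lintegral_map hH measurable_ofLp', hc₁, lintegral_smul_measure, smul_eq_mul,
          ← mul_assoc, ENNReal.inv_mul_cancel hc₁0 hc₁1, one_mul]
    _ = c₁⁻¹ * ∫⁻ v : EuclideanSpace ℂ (Fin m ⊕ Fin (k + 1)),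
          F (singSq (Fin.cons (Φ v).ofLp B : Fin (m + 1) → κ → ℂ)) := by
        congr 1
        exact ((measurePreserving_linearIsometryEquiv Φ).lintegral_comp
          (hH.comp measurable_ofLp')).symm
    _ = c₁⁻¹ * (c₂ * ∫⁻ w : Fin m ⊕ Fin (k + 1) → ℂ,
          F (singSq (Fin.cons (Φ (WithLp.toLp 2 w)).ofLp B : Fin (m + 1) → κ → ℂ))) := by
        have hK : Measurable fun w : Fin m ⊕ Fin (k + 1) → ℂ =>
            F (singSq (Fin.cons (Φ (WithLp.toLp 2 w)).ofLp B : Fin (m + 1) → κ → ℂ)) := by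
          refine hH.comp (Continuous.measurable ?_)
          exact (PiLp.continuous_ofLp 2 _).comp (Φ.continuous.comp (PiLp.continuous_toLp 2 _))
        rw [← smul_eq_mul c₂, ← lintegral_smul_measure, ← hc₂,
          lintegral_map hK measurable_ofLp']
    _ = c₁⁻¹ * (c₂ * (c₃ * ∫⁻ τ in Set.univ.pi fun _ => Set.Ioi 0,
          ENNReal.ofReal (τ 0 ^ k) * F (S τ))) := by
        simp only [hSw]
        rw [hc₃ (fun τ => F (S τ)) (hF.comp hS)]
    _ = _ := by
        rw [lintegral_orthant_eq hB, mul_assoc, mul_assoc]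
        congr 3
        refine setLIntegral_congr_fun (isOpen_interlacing _).measurableSet fun μ hμ => ?_
        simp only [hSμ μ hμ]

/-- The strictly increasing vectors with positive entries. -/
def chamber (m : ℕ) : Set (Fin m → ℝ) := {p | StrictMono p ∧ ∀ i, 0 < p i}

theorem measurableSet_chamber (m : ℕ) : MeasurableSet (chamber m) := by
  have : chamber m = (⋂ i, ⋂ j, ⋂ _ : i < j, {p | p i < p j}) ∩ ⋂ i, {p | 0 < p i} := by
    ext; simp [chamber, StrictMono]
  rw [this]
  refine (MeasurableSet.iInter fun i => MeasurableSet.iInter fun j => MeasurableSet.iInter fun _ =>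
    ?_).inter (MeasurableSet.iInter fun i => ?_)
  · exact measurableSet_lt (measurable_pi_apply i) (measurable_pi_apply j)
  · exact measurableSet_lt measurable_const (measurable_pi_apply i)

theorem strictMono_cons_zero {m : ℕ} {p : Fin m → ℝ} (hp : p ∈ chamber m) :
    StrictMono (Fin.cons 0 p : Fin (m + 1) → ℝ) := by
  intro i j h
  induction i using Fin.cases with
  | zero =>
    induction j using Fin.cases with
    | zero => exact absurd h (lt_irrefl _)
    | succ j => simpa using hp.2 j
  | succ i =>
    induction j using Fin.cases with
    | zero => exact absurd h (Fin.not_lt_zero _)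
    | succ j => simpa using hp.1 (Fin.succ_lt_succ_iff.1 h)

theorem vdm_cons_zero {m : ℕ} (p : Fin m → ℝ) :
    vdm (Fin.cons 0 p : Fin (m + 1) → ℝ) = (∏ i, p i) * vdm p := by
  simp [vdm, Fin.prod_univ_succ (n := m), Fin.prod_Ioi_succ]

theorem weights_cons_zero {m : ℕ} (p : Fin m → ℝ) (μ : Fin (m + 1) → ℝ) :
    weights (Fin.cons 0 p) μ 0 = (∏ i, μ i) / ∏ i, p i := by
  have h : (Finset.univ.erase (0 : Fin (m + 1))) = Finset.univ.map (Fin.succEmb m) := by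
    ext i; simp [Fin.exists_succ_eq]
  rw [weights, h]
  simp only [Fin.cons_zero, zero_sub, Finset.prod_map, Fin.coe_succEmb, Fin.cons_succ,
    Finset.prod_neg, Finset.card_map, Finset.card_univ, Fintype.card_fin]
  rw [pow_succ, mul_neg_one, neg_mul, neg_neg, mul_div_mul_left _ _ (by simp)]

theorem mem_interlacing_cons_zero {m : ℕ} {p : Fin m → ℝ} {μ : Fin (m + 1) → ℝ} :
    μ ∈ interlacing (Fin.cons 0 p) ↔ 0 < μ 0 ∧ p ∈ gaps μ := by
  simp only [interlacing, gaps, Set.mem_ofPred_eq, Fin.forall_fin_succ (n := m), Fin.cons_zero,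
    Fin.cons_succ, Set.mem_univ_pi, Set.mem_Ioo, forall_and]
  tauto

theorem mem_chamber_of_mem_gaps {m : ℕ} {p : Fin m → ℝ} {μ : Fin (m + 1) → ℝ}
    (hμ : μ ∈ chamber (m + 1)) (hp : p ∈ gaps μ) : p ∈ chamber m := by
  simp only [gaps, Set.mem_univ_pi, Set.mem_Ioo] at hp
  refine ⟨fun i j h => ?_, fun i => (hμ.2 _).trans (hp i).1⟩
  refine (hp i).2.trans_le (le_trans (hμ.1.monotone ?_) (hp j).1.le)
  exact Fin.succ_le_castSucc_iff.2 h

theorem mem_chamber_of_mem_interlacing {m : ℕ} {p : Fin m → ℝ} {μ : Fin (m + 1) → ℝ}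
    (hμ : μ ∈ interlacing (Fin.cons 0 p)) : μ ∈ chamber (m + 1) := by
  have h := interlacing.strictMono hμ
  exact ⟨h, fun i => (mem_interlacing_cons_zero.1 hμ).1.trans_le (h.monotone (Fin.zero_le i))⟩

theorem density_mul_kernel {m k : ℕ} {p : Fin m → ℝ} {μ : Fin (m + 1) → ℝ} (hp : p ∈ chamber m)
    (hμ : μ ∈ chamber (m + 1)) :
    ENNReal.ofReal (vdm p ^ 2 * ∏ i, p i ^ (k + 1)) *
      (ENNReal.ofReal (vdm μ / vdm (Fin.cons 0 p : Fin (m + 1) → ℝ)) *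
        ENNReal.ofReal (weights (Fin.cons 0 p) μ 0 ^ k)) =
      ENNReal.ofReal (vdm p) * ENNReal.ofReal (vdm μ * ∏ i, μ i ^ k) := by
  have h1 := vdm_pos hp.1
  have h2 := vdm_pos hμ.1
  have h3 : 0 < ∏ i, p i := Finset.prod_pos fun i _ => hp.2 i
  have h4 : 0 < ∏ i, μ i := Finset.prod_pos fun i _ => hμ.2 i
  rw [vdm_cons_zero, weights_cons_zero, Finset.prod_pow, Finset.prod_pow,
    ← ENNReal.ofReal_mul (by positivity), ← ENNReal.ofReal_mul (by positivity),
    ← ENNReal.ofReal_mul (by positivity)]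
  congr 1
  rw [div_pow]
  field_simp
  ring

theorem lintegral_density_mul_kernel {m k : ℕ} {μ : Fin (m + 1) → ℝ}
    (F : (Fin (m + 1) → ℝ) → ENNReal) :
    ∫⁻ p in chamber m, ENNReal.ofReal (vdm p ^ 2 * ∏ i, p i ^ (k + 1)) *
        {p : Fin m → ℝ | μ ∈ interlacing (Fin.cons 0 p)}.indicator
          (fun p => ENNReal.ofReal (vdm μ / vdm (Fin.cons 0 p : Fin (m + 1) → ℝ)) *
            (ENNReal.ofReal (weights (Fin.cons 0 p) μ 0 ^ k) * F μ)) p =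
      ENNReal.ofReal (∏ j : Fin m, ((j : ℝ) + 1)⁻¹) * (chamber (m + 1)).indicator
        (fun μ => ENNReal.ofReal (vdm μ ^ 2 * ∏ i, μ i ^ k) * F μ) μ := by
  by_cases hμ : μ ∈ chamber (m + 1)
  · have hset : {p : Fin m → ℝ | μ ∈ interlacing (Fin.cons 0 p)} = gaps μ := by
      ext p
      simp [mem_interlacing_cons_zero, hμ.2 0]
    have hgaps : MeasurableSet (gaps μ) := MeasurableSet.univ_pi fun _ => measurableSet_Ioo
    have hpos : 0 < vdm μ := vdm_pos hμ.1
    calc _ = ∫⁻ p in chamber m, (gaps μ).indicator (fun p => ENNReal.ofReal (vdm p) *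
            (ENNReal.ofReal (vdm μ * ∏ i, μ i ^ k) * F μ)) p := by
          refine setLIntegral_congr_fun (measurableSet_chamber m) fun p hp => ?_
          rw [hset]
          by_cases h : p ∈ gaps μ
          · simp only [Set.indicator_of_mem h]
            rw [← mul_assoc _ _ (F μ), ← mul_assoc _ _ (F μ), density_mul_kernel hp hμ, mul_assoc]
          · simp [Set.indicator_of_notMem h]
      _ = ∫⁻ p in gaps μ, ENNReal.ofReal (vdm p) *
            (ENNReal.ofReal (vdm μ * ∏ i, μ i ^ k) * F μ) := by
          rw [setLIntegral_indicator hgaps, Set.inter_eq_left.2 fun p hp =>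
            mem_chamber_of_mem_gaps hμ hp]
      _ = _ := by
          rw [lintegral_mul_const _ continuous_vdm.measurable.ennreal_ofReal,
            lintegral_gaps_vdm hμ.1, Set.indicator_of_mem hμ, mul_assoc, ← mul_assoc _ _ (F μ),
            ← ENNReal.ofReal_mul hpos.le, sq, mul_assoc (vdm μ)]
  · have hset : {p : Fin m → ℝ | μ ∈ interlacing (Fin.cons 0 p)} = ∅ :=
      Set.eq_empty_of_forall_notMem fun p hp => hμ (mem_chamber_of_mem_interlacing hp)
    simp [hset, hμ]

theorem measurable_cons_zero {m : ℕ} :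
    Measurable fun p : Fin m → ℝ => (Fin.cons 0 p : Fin (m + 1) → ℝ) := by
  refine measurable_pi_lambda _ fun i => ?_
  induction i using Fin.cases with
  | zero => simp
  | succ i => simpa using measurable_pi_apply i

theorem exists_lintegral_singSq (m d : ℕ) {κ : Type*} [Fintype κ] (hκ : Fintype.card κ = m + d) :
    ∃ c : ENNReal, c ≠ 0 ∧ c ≠ ⊤ ∧ ∀ F : (Fin m → ℝ) → ENNReal, Measurable F →
      ∫⁻ A : Fin m → κ → ℂ, F (singSq A) =
        c * ∫⁻ p in chamber m, ENNReal.ofReal (vdm p ^ 2 * ∏ i, p i ^ d) * F p := by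
  induction m generalizing d with
  | zero =>
    refine ⟨1, one_ne_zero, ENNReal.one_ne_top, fun F hF => ?_⟩
    have : chamber 0 = Set.univ :=
      Set.eq_univ_of_forall fun p => ⟨fun i => i.elim0, fun i => i.elim0⟩
    have h : ∀ A : Fin 0 → κ → ℂ, singSq A = default := fun A => Subsingleton.elim _ _
    have h' : ∫⁻ p : Fin 0 → ℝ, F p = F default := by
      simp [lintegral_unique, volume_pi]
      exact congrArg F (Subsingleton.elim _ _)
    have h0 : ∫⁻ A : Fin 0 → κ → ℂ, F default = F default := by
      simp [volume_pi]
    simp only [h, h0, this, Measure.restrict_univ, vdm]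
    simp [h']
  | succ m ih =>
    obtain ⟨c₁, h₁, h₁', H₁⟩ := exists_lintegral_singSq_cons (κ := κ) (m := m) (k := d) (by omega)
    obtain ⟨c₂, h₂, h₂', H₂⟩ := ih (d + 1) (by omega)
    refine ⟨c₁ * (c₂ * ENNReal.ofReal (∏ j : Fin m, ((j : ℝ) + 1)⁻¹)),
      mul_ne_zero h₁ (mul_ne_zero h₂ ?_), ENNReal.mul_ne_top h₁' (ENNReal.mul_ne_top h₂'
        ENNReal.ofReal_ne_top), fun F hF => ?_⟩
    · have : 0 < ∏ j : Fin m, ((j : ℝ) + 1)⁻¹ := Finset.prod_pos fun j _ => by positivity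
      simpa using this
    have hae : ∀ᵐ B : Fin m → κ → ℂ, singSq B ∈ chamber m := by
      have h := H₂ ((chamber m)ᶜ.indicator 1)
        (measurable_one.indicator (measurableSet_chamber m).compl)
      rw [setLIntegral_congr_fun (g := 0) (measurableSet_chamber m) (fun p hp => by simp [hp])] at h
      simp only [Pi.zero_apply, lintegral_zero, mul_zero] at h
      have hmeas : Measurable fun B : Fin m → κ → ℂ =>
          (chamber m)ᶜ.indicator (1 : (Fin m → ℝ) → ENNReal) (singSq B) :=
        (measurable_one.indicator (measurableSet_chamber m).compl).comp measurable_singSq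
      rw [lintegral_eq_zero_iff hmeas] at h
      filter_upwards [h] with B hB
      by_contra hc
      simp [hc] at hB
    set J : (Fin m → ℝ) → (Fin (m + 1) → ℝ) → ENNReal := fun p μ =>
      {p : Fin m → ℝ | μ ∈ interlacing (Fin.cons 0 p)}.indicator
          (fun p => ENNReal.ofReal (vdm μ / vdm (Fin.cons 0 p : Fin (m + 1) → ℝ)) *
            (ENNReal.ofReal (weights (Fin.cons 0 p) μ 0 ^ d) * F μ)) p with hJ
    have hc : Measurable fun x : (Fin m → ℝ) × (Fin (m + 1) → ℝ) =>
        (Fin.cons 0 x.1 : Fin (m + 1) → ℝ) := measurable_cons_zero.comp measurable_fst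
    have hci : ∀ i, Measurable fun x : (Fin m → ℝ) × (Fin (m + 1) → ℝ) =>
        (Fin.cons 0 x.1 : Fin (m + 1) → ℝ) i := fun i => (measurable_pi_apply i).comp hc
    have hmi : ∀ i, Measurable fun x : (Fin m → ℝ) × (Fin (m + 1) → ℝ) => x.2 i :=
      fun i => (measurable_pi_apply i).comp measurable_snd
    have hJm : Measurable (Function.uncurry J) := by
      have hS : MeasurableSet {x : (Fin m → ℝ) × (Fin (m + 1) → ℝ) |
          x.2 ∈ interlacing (Fin.cons 0 x.1)} := by
        have : {x : (Fin m → ℝ) × (Fin (m + 1) → ℝ) | x.2 ∈ interlacing (Fin.cons 0 x.1)} =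
            (⋂ i, {x | (Fin.cons 0 x.1 : Fin (m + 1) → ℝ) i < x.2 i}) ∩
              ⋂ i : Fin m, {x | x.2 i.castSucc < (Fin.cons 0 x.1 : Fin (m + 1) → ℝ) i.succ} := by
          ext; simp [interlacing]
        rw [this]
        exact (MeasurableSet.iInter fun i => measurableSet_lt (hci i) (hmi i)).inter
          (MeasurableSet.iInter fun i => measurableSet_lt (hmi _) (hci _))
      refine Measurable.indicator (f := fun x : (Fin m → ℝ) × (Fin (m + 1) → ℝ) =>
        ENNReal.ofReal (vdm x.2 / vdm (Fin.cons 0 x.1 : Fin (m + 1) → ℝ)) *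
            (ENNReal.ofReal (weights (Fin.cons 0 x.1) x.2 0 ^ d) * F x.2)) ?_ hS
      have h1 := continuous_vdm.measurable.comp hc
      have h2 : Measurable fun x : (Fin m → ℝ) × (Fin (m + 1) → ℝ) => vdm x.2 :=
        continuous_vdm.measurable.comp measurable_snd
      have h3 : Measurable fun x : (Fin m → ℝ) × (Fin (m + 1) → ℝ) =>
          weights (Fin.cons 0 x.1) x.2 0 :=
        (Finset.measurable_prod _ fun j _ => (hci 0).sub (hmi j)).neg.div
          (Finset.measurable_prod _ fun j _ => (hci 0).sub (hci j))
      exact (h2.div h1).ennreal_ofReal.mul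
        ((h3.pow_const d).ennreal_ofReal.mul (hF.comp measurable_snd))
    have hK : Measurable fun p => ∫⁻ μ, J p μ := hJm.lintegral_prod_right'
    have hD : Measurable fun p : Fin m → ℝ =>
        ENNReal.ofReal (vdm p ^ 2 * ∏ i, p i ^ (d + 1)) := by
      refine Measurable.ennreal_ofReal (Continuous.measurable ?_)
      exact (continuous_vdm.pow 2).mul (by fun_prop)
    have hE : Measurable ((chamber (m + 1)).indicator
        (fun μ => ENNReal.ofReal (vdm μ ^ 2 * ∏ i, μ i ^ d) * F μ)) := by
      refine Measurable.indicator (Measurable.mul (Measurable.ennreal_ofReal ?_) hF)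
        (measurableSet_chamber _)
      exact ((continuous_vdm.pow 2).mul (by fun_prop)).measurable
    calc ∫⁻ A : Fin (m + 1) → κ → ℂ, F (singSq A)
        = ∫⁻ B : Fin m → κ → ℂ, ∫⁻ r, F (singSq (Fin.cons r B)) :=
          lintegral_finCons (hF.comp measurable_singSq)
      _ = ∫⁻ B : Fin m → κ → ℂ, c₁ * ∫⁻ μ, J (singSq B) μ := by
          refine lintegral_congr_ae ?_
          filter_upwards [hae] with B hB
          rw [H₁ B (strictMono_cons_zero hB) F hF,
            ← lintegral_indicator (isOpen_interlacing _).measurableSet]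
          rfl
      _ = c₁ * (c₂ * ∫⁻ p in chamber m, ∫⁻ μ,
            ENNReal.ofReal (vdm p ^ 2 * ∏ i, p i ^ (d + 1)) * J p μ) := by
          have hK' : Measurable fun B : Fin m → κ → ℂ => ∫⁻ μ, J (singSq B) μ :=
            hK.comp measurable_singSq
          rw [lintegral_const_mul _ hK', H₂ _ hK]
          congr 3
          ext p
          rw [lintegral_const_mul]
          exact hJm.comp measurable_prodMk_left
      _ = _ := by
          rw [lintegral_lintegral_swap]
          · simp only [hJ]
            simp_rw [lintegral_density_mul_kernel]
            rw [lintegral_const_mul _ hE, lintegral_indicator (measurableSet_chamber _),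
              ← mul_assoc c₂, mul_assoc c₁]
          · exact ((hD.comp measurable_fst).mul hJm).aemeasurable

open Polynomial in
theorem singSq_smul {m : ℕ} {κ : Type*} [Fintype κ] {t : ℝ} (ht : 0 < t) (A : Fin m → κ → ℂ) :
    singSq ((t : ℂ) • A) = t ^ 2 • singSq A := by
  refine singSq_eq_of_charpoly_eq
    (fun i j h => mul_le_mul_of_nonneg_left (monotone_singSq A h) (sq_nonneg t)) ?_
  have ht' : (t : ℂ) ≠ 0 := by exact_mod_cast ht.ne'
  have h1 : Matrix.of ((t : ℂ) • A) * (Matrix.of ((t : ℂ) • A))ᴴ =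
      (t ^ 2 : ℂ) • (Matrix.of A * (Matrix.of A)ᴴ) := by
    have : Matrix.of ((t : ℂ) • A) = (t : ℂ) • Matrix.of A := rfl
    rw [this, conjTranspose_smul, Matrix.smul_mul, Matrix.mul_smul, smul_smul, sq]
    simp
  refine Polynomial.funext fun x => ?_
  have h2 : scalar (Fin m) x - (t ^ 2 : ℂ) • (Matrix.of A * (Matrix.of A)ᴴ) =
      (t ^ 2 : ℂ) • (scalar (Fin m) (x / t ^ 2) - Matrix.of A * (Matrix.of A)ᴴ) := by
    rw [smul_sub]
    congr 1
    ext i j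
    by_cases h : i = j
    · subst h
      simp
      field_simp
    · simp [h]
  have h3 := congrArg (Polynomial.eval (x / t ^ 2)) (charpoly_eq_prod_singSq A)
  rw [eval_charpoly] at h3
  rw [h1, eval_charpoly, h2, det_smul, h3, Fintype.card_fin]
  simp only [Polynomial.map_prod, Polynomial.map_sub, map_X, map_C, eval_prod, eval_sub, eval_X,
    eval_C, Pi.smul_apply, smul_eq_mul]
  have h4 : ((t : ℂ) ^ 2) ^ m = ∏ _i : Fin m, (t : ℂ) ^ 2 := by simp
  rw [h4, ← Finset.prod_mul_distrib]
  refine Finset.prod_congr rfl fun i _ => ?_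
  simp
  field_simp

theorem vdm_comp_sq {m : ℕ} (p : Fin m → ℝ) (σ : Equiv.Perm (Fin m)) :
    vdm (p ∘ σ) ^ 2 = vdm p ^ 2 := by
  have h : vandermonde (p ∘ σ) = (vandermonde p).submatrix σ id := rfl
  rw [← det_vandermonde_eq_vdm, ← det_vandermonde_eq_vdm, h, det_permute, mul_pow]
  rcases Int.units_eq_one_or (Equiv.Perm.sign σ) with h | h <;> simp [h]

theorem ae_injective_and_ne_zero (m : ℕ) :
    ∀ᵐ p : Fin m → ℝ, Function.Injective p ∧ ∀ i, p i ≠ 0 := by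
  have h1 : ∀ i j, i ≠ j → ∀ᵐ p : Fin m → ℝ, p i ≠ p j := fun i j hij => by
    let L : (Fin m → ℝ) →ₗ[ℝ] ℝ := LinearMap.proj (R := ℝ) (φ := fun _ : Fin m => ℝ) i -
      LinearMap.proj (R := ℝ) (φ := fun _ : Fin m => ℝ) j
    have hL : LinearMap.ker L ≠ ⊤ := fun h => by
      have : L (Pi.single i 1) = 0 := by
        rw [← LinearMap.mem_ker, h]; trivial
      simp [L, hij.symm] at this
    refine measure_mono_null (fun p hp => ?_)
      (Measure.addHaar_submodule (volume : Measure (Fin m → ℝ)) _ hL)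
    simp only [ne_eq, Set.mem_compl_iff, Set.mem_ofPred_eq, not_not] at hp
    simp [L, hp]
  have h2 : ∀ i, ∀ᵐ p : Fin m → ℝ, p i ≠ 0 := fun i =>
    Measure.ae_eval_ne (μ := fun _ : Fin m => (volume : Measure ℝ)) i 0
  have h3 : ∀ᵐ p : Fin m → ℝ, ∀ i j, i ≠ j → p i ≠ p j :=
    ae_all_iff.2 fun i => ae_all_iff.2 fun j => by
      by_cases h : i = j
      · simp [h]
      · filter_upwards [h1 i j h] with p hp _ using hp
  filter_upwards [h3, ae_all_iff.2 h2] with p hp hne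
  exact ⟨fun i j h => by_contra fun hij => hp i j hij h, hne⟩

/-- The points of the corner simplex with strictly increasing positive coordinates. -/
def orderedSimplex (m : ℕ) : Set (Fin m → ℝ) := chamber m ∩ {p | ∑ i, p i ≤ 1}

theorem measurableSet_orderedSimplex (m : ℕ) : MeasurableSet (orderedSimplex m) :=
  (measurableSet_chamber m).inter
    (isClosed_le (by fun_prop) continuous_const).measurableSet

theorem comp_mem_cornerSimplex {m : ℕ} {p : Fin m → ℝ} {σ : Equiv.Perm (Fin m)}
    (h : p ∘ σ ∈ orderedSimplex m) : p ∈ cornerSimplex m := by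
  refine ⟨fun j => ?_, ?_⟩
  · simpa using (h.1.2 (σ.symm j)).le
  · simpa [Equiv.sum_comp σ p] using h.2

theorem setIntegral_cornerSimplex {m : ℕ} {h : (Fin m → ℝ) → ℝ}
    (hsym : ∀ (σ : Equiv.Perm (Fin m)) (p : Fin m → ℝ), h (p ∘ σ) = h p)
    (h_int : IntegrableOn h (cornerSimplex m)) :
    ∫ p in cornerSimplex m, h p = (m.factorial : ℝ) * ∫ p in orderedSimplex m, h p := by
  let e : Equiv.Perm (Fin m) → (Fin m → ℝ) ≃ᵐ (Fin m → ℝ) := fun σ =>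
    MeasurableEquiv.piCongrLeft (fun _ => ℝ) σ.symm
  have he : ∀ σ p, e σ p = p ∘ σ := fun σ p => by
    ext i
    obtain ⟨a, rfl⟩ := σ.symm.surjective i
    have := Equiv.piCongrLeft_apply_apply (fun _ : Fin m => ℝ) σ.symm p a
    rw [Function.comp_apply, Equiv.apply_symm_apply]
    exact this
  let s : Equiv.Perm (Fin m) → Set (Fin m → ℝ) := fun σ => e σ ⁻¹' orderedSimplex m
  have hsub : ∀ σ, s σ ⊆ cornerSimplex m := fun σ p hp =>
    comp_mem_cornerSimplex (σ := σ) (by simpa [s, he] using hp)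
  have hU : cornerSimplex m =ᵐ[volume] ⋃ σ, s σ := by
    filter_upwards [ae_injective_and_ne_zero m] with p hp
    refine propext ⟨fun hpc => ?_, fun hpu => ?_⟩
    · refine Set.mem_iUnion.2 ⟨Tuple.sort p, ?_⟩
      change e (Tuple.sort p) p ∈ orderedSimplex m
      rw [he]
      refine ⟨⟨(Tuple.monotone_sort p).strictMono_of_injective
        (hp.1.comp (Tuple.sort p).injective), fun i => (hpc.1 _).lt_of_ne' (hp.2 _)⟩, ?_⟩
      simpa [Equiv.sum_comp (Tuple.sort p) p] using hpc.2
    · obtain ⟨σ, hσ⟩ := Set.mem_iUnion.1 hpu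
      exact hsub σ hσ
  have hd : Pairwise (Function.onFun Disjoint s) := fun σ τ hστ =>
    Set.disjoint_left.2 fun p hpσ hpτ => hστ <| by
      simp only [s, Set.mem_preimage, he] at hpσ hpτ
      have hr : Set.range (p ∘ σ) = Set.range (p ∘ τ) := by
        rw [σ.surjective.range_comp, τ.surjective.range_comp]
      have h1 := (StrictMono.range_inj hpσ.1.1 hpτ.1.1).1 hr
      have hinj : Function.Injective p := by
        have := hpσ.1.1.injective.comp σ.symm.injective
        rwa [Function.comp_assoc, Equiv.self_comp_symm, Function.comp_id] at this
      exact Equiv.ext fun i => hinj (congrFun h1 i)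
  rw [setIntegral_congr_set hU, integral_iUnion_fintype
    (fun σ => (e σ).measurable (measurableSet_orderedSimplex m)) hd
    (fun σ => h_int.mono_set (hsub σ))]
  have h1 : ∀ σ, ∫ p in s σ, h p = ∫ p in orderedSimplex m, h p := fun σ => by
    have h2 := (volume_measurePreserving_piCongrLeft (fun _ : Fin m => ℝ)
      σ.symm).setIntegral_preimage_emb (e σ).measurableEmbedding h (orderedSimplex m)
    refine Eq.trans (integral_congr_ae (ae_of_all _ fun p => ?_)) h2
    change h p = h (e σ p)
    rw [he, hsym]
  rw [Finset.sum_congr rfl fun σ _ => h1 σ]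
  simp only [Finset.sum_const, Finset.card_univ, Fintype.card_perm, Fintype.card_fin,
    nsmul_eq_mul]

/-- The coefficients of `v`, as a function. -/
def coeffs {m n : ℕ} (v : TensorSp m n) : Fin m → Fin n → ℂ := fun j k => v (j, k)

theorem exists_map_coeffs (m n : ℕ) : ∃ c : ENNReal, c ≠ 0 ∧ c ≠ ⊤ ∧
    (volume : Measure (TensorSp m n)).map coeffs = c • volume := by
  let L : TensorSp m n ≃L[ℂ] (Fin m → Fin n → ℂ) :=
    ((WithLp.linearEquiv 2 ℂ (Fin m × Fin n → ℂ)).trans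
      (LinearEquiv.curry ℂ ℂ (Fin m) (Fin n))).toContinuousLinearEquiv
  have : (volume : Measure (Fin n → ℂ)).IsAddHaarMeasure := inferInstance
  have : (volume : Measure (Fin m → Fin n → ℂ)).IsAddHaarMeasure :=
    Measure.pi.isAddHaarMeasure fun _ : Fin m => (volume : Measure (Fin n → ℂ))
  have : (Measure.map L (volume : Measure (TensorSp m n))).IsAddHaarMeasure :=
    L.isAddHaarMeasure_map _
  refine ⟨Measure.addHaarScalarFactor
    (Measure.map L (volume : Measure (TensorSp m n))) volume, ?_, ENNReal.coe_ne_top,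
    Measure.isAddLeftInvariant_eq_smul (Measure.map L volume) volume⟩
  exact ENNReal.coe_ne_zero.2 (Measure.addHaarScalarFactor_pos_of_isAddHaarMeasure _ _).ne'

theorem measurable_coeffs {m n : ℕ} : Measurable (coeffs : TensorSp m n → _) :=
  measurable_pi_lambda _ fun j => measurable_pi_lambda _ fun k =>
    (measurable_pi_apply (j, k)).comp measurable_ofLp'

theorem sum_singSq_coeffs {m n : ℕ} (v : TensorSp m n) :
    ∑ i, singSq (coeffs v) i = ‖v‖ ^ 2 := by
  rw [sum_singSq, EuclideanSpace.norm_sq_eq, Fintype.sum_prod_type]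
  rfl

theorem singSq_coeffs_smul {m n : ℕ} {t : ℝ} (ht : 0 < t) (v : TensorSp m n) :
    singSq (coeffs (t • v)) = t ^ 2 • singSq (coeffs v) := by
  rw [← singSq_smul ht]
  rfl

/-- The joint density of the squared singular values. -/
def density (m d : ℕ) (p : Fin m → ℝ) : ℝ := vdm p ^ 2 * ∏ i, p i ^ d

theorem continuous_density (m d : ℕ) : Continuous (density m d) :=
  (continuous_vdm.pow 2).mul (by fun_prop)

/-- Rescaling of a vector to total sum one. -/
def sumNormalize {m : ℕ} (p : Fin m → ℝ) : Fin m → ℝ := fun j => p j / ∑ k, p k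

theorem measurable_sumNormalize {m : ℕ} : Measurable (sumNormalize : (Fin m → ℝ) → Fin m → ℝ) :=
  measurable_pi_lambda _ fun j => (measurable_pi_apply j).div
    (Finset.measurable_sum _ fun k _ => measurable_pi_apply k)

theorem sumNormalize_singSq_smul {m n : ℕ} {t : ℝ} (ht : 0 < t) {v : TensorSp m n} (hv : ‖v‖ = 1) :
    sumNormalize (singSq (coeffs (t • v))) = singSq (coeffs v) := by
  ext j
  rw [sumNormalize, sum_singSq_coeffs, singSq_coeffs_smul ht, norm_smul, hv]
  simp [ht.ne']

open scoped Pointwise in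
theorem exists_map_toSphere {m n : ℕ} (hm : 1 ≤ m) (hmn : m ≤ n) :
    ∃ c : ENNReal, c ≠ 0 ∧ c ≠ ⊤ ∧
      ((volume : Measure (TensorSp m n)).toSphere).map
        (fun u : Metric.sphere (0 : TensorSp m n) 1 => singSq (coeffs (u : TensorSp m n))) =
        c • ((volume.restrict (orderedSimplex m)).withDensity
          fun p => ENNReal.ofReal (density m (n - m) p)).map sumNormalize := by
  obtain ⟨a, ha, ha', hA⟩ := exists_map_coeffs m n
  obtain ⟨b, hb, hb', hB⟩ := exists_lintegral_singSq m (n - m) (κ := Fin n) (by simp; omega)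
  have : Nonempty (Fin m × Fin n) := ⟨⟨0, hm⟩, ⟨0, by omega⟩⟩
  have hdim : Module.finrank ℝ (TensorSp m n) ≠ 0 := Module.finrank_pos.ne'
  have hΦ : Measurable fun v : TensorSp m n => singSq (coeffs v) :=
    measurable_singSq.comp measurable_coeffs
  have hΦ' : Measurable fun u : Metric.sphere (0 : TensorSp m n) 1 =>
      singSq (coeffs (u : TensorSp m n)) := hΦ.comp measurable_subtype_coe
  refine ⟨Module.finrank ℝ (TensorSp m n) * (a * b),
    mul_ne_zero (by exact_mod_cast hdim) (mul_ne_zero ha hb),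
    ENNReal.mul_ne_top (ENNReal.natCast_ne_top _) (ENNReal.mul_ne_top ha' hb'), ?_⟩
  ext S hS
  let V : Set (Fin m → ℝ) := {p | ∑ i, p i ≤ 1} ∩ sumNormalize ⁻¹' S
  have hV : MeasurableSet V :=
    (isClosed_le (by fun_prop) continuous_const).measurableSet.inter (measurable_sumNormalize hS)
  have hset : Set.Ioo (0 : ℝ) 1 • (Subtype.val '' ((fun u : Metric.sphere (0 : TensorSp m n) 1 =>
      singSq (coeffs (u : TensorSp m n))) ⁻¹' S)) =ᵐ[volume]
      (fun v : TensorSp m n => singSq (coeffs v)) ⁻¹' V := by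
    have h0 : ∀ᵐ v : TensorSp m n, v ≠ 0 := by
      simp [ae_iff]
    have h1 : ∀ᵐ v : TensorSp m n, v ∉ Metric.sphere (0 : TensorSp m n) 1 :=
      measure_eq_zero_iff_ae_notMem.1 (Measure.addHaar_sphere _ _ _)
    filter_upwards [h0, h1] with v hv0 hv1
    refine propext ⟨fun h => ?_, fun h => ?_⟩
    · obtain ⟨t, ht, w, ⟨u, hu, rfl⟩, rfl⟩ := Set.mem_smul.1 h
      have hu1 : ‖(u : TensorSp m n)‖ = 1 := by simp
      refine ⟨?_, ?_⟩
      · change ∑ i, singSq (coeffs (t • (u : TensorSp m n))) i ≤ 1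
        rw [sum_singSq_coeffs, norm_smul, hu1, mul_one, Real.norm_of_nonneg ht.1.le]
        exact pow_le_one₀ ht.1.le ht.2.le
      · change sumNormalize (singSq (coeffs (t • (u : TensorSp m n)))) ∈ S
        rw [sumNormalize_singSq_smul ht.1 hu1]
        exact hu
    · have hpos : 0 < ‖v‖ := norm_pos_iff.2 hv0
      have hle : ‖v‖ ^ 2 ≤ 1 := by
        have := h.1
        rwa [Set.mem_ofPred_eq, sum_singSq_coeffs] at this
      have hlt : ‖v‖ < 1 := lt_of_le_of_ne (by nlinarith) (by simpa using hv1)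
      have hn : ‖‖v‖⁻¹ • v‖ = 1 := by
        rw [norm_smul, norm_inv, norm_norm, inv_mul_cancel₀ hpos.ne']
      have hs : ‖v‖ • ‖v‖⁻¹ • v = v := smul_inv_smul₀ hpos.ne' v
      refine Set.mem_smul.2 ⟨‖v‖, ⟨hpos, hlt⟩, ‖v‖⁻¹ • v, ⟨⟨‖v‖⁻¹ • v, by simpa using hn⟩, ?_, rfl⟩,
        hs⟩
      change singSq (coeffs (‖v‖⁻¹ • v)) ∈ S
      rw [← sumNormalize_singSq_smul hpos hn, hs]
      exact h.2
  have hD : Measurable fun p : Fin m → ℝ => ENNReal.ofReal (density m (n - m) p) :=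
    (continuous_density _ _).measurable.ennreal_ofReal
  have hvol : volume ((fun v : TensorSp m n => singSq (coeffs v)) ⁻¹' V) =
      a * (b * ∫⁻ p in V ∩ chamber m, ENNReal.ofReal (density m (n - m) p)) := by
    have h1 : (fun v : TensorSp m n => singSq (coeffs v)) ⁻¹' V =
        coeffs ⁻¹' ((singSq : (Fin m → Fin n → ℂ) → _) ⁻¹' V) := rfl
    rw [h1, ← Measure.map_apply measurable_coeffs (measurable_singSq hV), hA, Measure.smul_apply,
      smul_eq_mul, ← lintegral_indicator_one (measurable_singSq hV)]
    have h2 := hB (V.indicator 1) (measurable_one.indicator hV)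
    congr 1
    refine Eq.trans (lintegral_congr fun A => rfl) (h2.trans ?_)
    rw [← setLIntegral_indicator hV]
    congr 1
    refine lintegral_congr fun p => ?_
    by_cases hp : p ∈ V <;> simp [hp, density]
  rw [Measure.map_apply hΦ' hS, Measure.toSphere_apply' _ (hΦ' hS), measure_congr hset, hvol,
    Measure.smul_apply, Measure.map_apply measurable_sumNormalize hS,
    withDensity_apply _ (measurable_sumNormalize hS),
    Measure.restrict_restrict (measurable_sumNormalize hS), smul_eq_mul, mul_assoc, mul_assoc]
  congr 5
  ext p
  simp only [V, orderedSimplex, Set.mem_inter_iff]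
  tauto

theorem exists_integral_toSphere {m n : ℕ} (hm : 1 ≤ m) (hmn : m ≤ n) :
    ∃ c : ℝ, c ≠ 0 ∧ ∀ g : (Fin m → ℝ) → ℝ, Continuous g →
      ∫ u, g (singSq (coeffs (u : TensorSp m n)))
          ∂((volume : Measure (TensorSp m n)).toSphere) =
        c * ∫ p in orderedSimplex m, g (sumNormalize p) * density m (n - m) p := by
  obtain ⟨c, hc, hc', h⟩ := exists_map_toSphere hm hmn
  refine ⟨c.toReal, ENNReal.toReal_ne_zero.2 ⟨hc, hc'⟩, fun g hg => ?_⟩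
  have hΦ : Measurable fun u : Metric.sphere (0 : TensorSp m n) 1 =>
      singSq (coeffs (u : TensorSp m n)) :=
    (measurable_singSq.comp measurable_coeffs).comp measurable_subtype_coe
  rw [← integral_map (f := g) hΦ.aemeasurable hg.aestronglyMeasurable, h, integral_smul_measure,
    integral_map measurable_sumNormalize.aemeasurable hg.aestronglyMeasurable,
    integral_withDensity_eq_integral_toReal_smul
      (continuous_density _ _).measurable.ennreal_ofReal (by simp), smul_eq_mul]
  congr 1
  refine setIntegral_congr_fun (measurableSet_orderedSimplex m) fun p hp => ?_
  have : 0 ≤ density m (n - m) p :=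
    mul_nonneg (sq_nonneg _) (Finset.prod_nonneg fun i _ => pow_nonneg (hp.1.2 i).le _)
  simp [ENNReal.toReal_ofReal this, mul_comm]

theorem density_comp (m d : ℕ) (σ : Equiv.Perm (Fin m)) (p : Fin m → ℝ) :
    density m d (p ∘ σ) = density m d p := by
  rw [density, density, vdm_comp_sq]
  congr 1
  exact Equiv.prod_comp σ fun i => p i ^ d

theorem sumNormalize_comp {m : ℕ} (σ : Equiv.Perm (Fin m)) (p : Fin m → ℝ) :
    sumNormalize (p ∘ σ) = sumNormalize p ∘ σ := by
  ext j
  simp [sumNormalize, Equiv.sum_comp σ p]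

theorem cornerSimplex_subset_Icc (m : ℕ) : cornerSimplex m ⊆ Set.Icc 0 1 := fun _ hp =>
  ⟨fun j => hp.1 j, fun j =>
    (Finset.single_le_sum (fun i _ => hp.1 i) (Finset.mem_univ j)).trans hp.2⟩

theorem sumNormalize_mem_Icc {m : ℕ} {p : Fin m → ℝ} (hp : ∀ j, 0 ≤ p j) :
    sumNormalize p ∈ Set.Icc (0 : Fin m → ℝ) 1 :=
  ⟨fun j => div_nonneg (hp j) (Finset.sum_nonneg fun i _ => hp i), fun j =>
    div_le_one_of_le₀ (Finset.single_le_sum (fun i _ => hp i) (Finset.mem_univ j))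
      (Finset.sum_nonneg fun i _ => hp i)⟩

theorem integrableOn_cornerSimplex {m : ℕ} (d : ℕ) {g : (Fin m → ℝ) → ℝ} (hg : Continuous g) :
    IntegrableOn (fun p => g (sumNormalize p) * density m d p) (cornerSimplex m) := by
  obtain ⟨a, ha⟩ := isCompact_Icc.exists_bound_of_continuousOn (s := Set.Icc (0 : Fin m → ℝ) 1)
    hg.continuousOn
  obtain ⟨b, hb⟩ := isCompact_Icc.exists_bound_of_continuousOn (s := Set.Icc (0 : Fin m → ℝ) 1)
    (continuous_density m d).continuousOn
  have hmeas : MeasurableSet (cornerSimplex m) := by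
    have : cornerSimplex m = (⋂ j, {p | 0 ≤ p j}) ∩ {p | ∑ j, p j ≤ 1} := by
      ext; simp [cornerSimplex]
    rw [this]
    exact (MeasurableSet.iInter fun j => measurableSet_le measurable_const
      (measurable_pi_apply j)).inter (isClosed_le (by fun_prop) continuous_const).measurableSet
  refine Measure.integrableOn_of_bounded (M := a * b)
    (measure_ne_top_of_subset (cornerSimplex_subset_Icc m) isCompact_Icc.measure_lt_top.ne)
    ((hg.measurable.comp measurable_sumNormalize).mul
      (continuous_density m d).measurable).aestronglyMeasurable ?_
  filter_upwards [ae_restrict_mem hmeas] with p hp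
  rw [norm_mul]
  have h := ha _ (sumNormalize_mem_Icc hp.1)
  exact mul_le_mul h (hb _ (cornerSimplex_subset_Icc m hp)) (norm_nonneg _)
    ((norm_nonneg _).trans h)

/-- For `1 ≤ m ≤ n` and a continuous symmetric function
`g : ℝ^m → ℝ`, the integral over the unit sphere of `ℂ^m ⊗ ℂ^n` of
`u ↦ g(p_1(u),…,p_m(u))` (where `p_j(u)` are the eigenvalues of the reduced
density matrix of `u`) equals the ratio of integrals over the simplex `T_m`
against the joint eigenvalue density
`∏_{j<k}(p_k−p_j)² ∏_j p_j^{n−m}`. -/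
theorem sphere_integral_of_schmidt_function (m n : ℕ) (hm : 1 ≤ m) (hmn : m ≤ n)
    (g : (Fin m → ℝ) → ℝ) (hg : Continuous g)
    (hsym : ∀ (σ : Equiv.Perm (Fin m)) (x : Fin m → ℝ), g (x ∘ σ) = g x) :
    (∫ u, g (schmidtSq (u : TensorSp m n)) ∂(sphereUniform m n)) =
      (∫ p in cornerSimplex m,
          g (fun j => p j / ∑ k, p k) *
            ((∏ j, ∏ k ∈ Finset.Ioi j, (p k - p j) ^ 2) * ∏ j, p j ^ (n - m))) /
      (∫ p in cornerSimplex m,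
          (∏ j, ∏ k ∈ Finset.Ioi j, (p k - p j) ^ 2) * ∏ j, p j ^ (n - m)) := by
  have hdens : ∀ p : Fin m → ℝ, (∏ j, ∏ k ∈ Finset.Ioi j, (p k - p j) ^ 2) * ∏ j, p j ^ (n - m) =
      density m (n - m) p := fun p => by
    simp only [density, vdm, Finset.prod_pow]
  have hschmidt : ∀ v : TensorSp m n, g (schmidtSq v) = g (singSq (coeffs v)) := fun v => by
    obtain ⟨σ, hσ⟩ := exists_eigenvalues_eq_singSq (coeffs v)
    have h : schmidtSq v = singSq (coeffs v) ∘ σ := hσ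
    rw [h, hsym]
  obtain ⟨c, hc, H⟩ := exists_integral_toSphere hm hmn
  have h1 := H (fun _ => 1) continuous_const
  simp only [integral_const, smul_eq_mul, mul_one, one_mul] at h1
  have h2 := setIntegral_cornerSimplex (h := fun p => g (sumNormalize p) * density m (n - m) p)
    (fun σ p => by rw [sumNormalize_comp, density_comp, hsym]) (integrableOn_cornerSimplex _ hg)
  have h3 := setIntegral_cornerSimplex (h := density m (n - m)) (density_comp m (n - m))
    (by simpa using integrableOn_cornerSimplex (m := m) (n - m) (g := fun _ => 1) continuous_const)
  have hfac : (m.factorial : ℝ) ≠ 0 := by exact_mod_cast m.factorial_ne_zero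
  simp only [hdens, hschmidt]
  change _ = (∫ p in cornerSimplex m, g (sumNormalize p) * density m (n - m) p) / _
  rw [h2, h3, mul_div_mul_left _ _ hfac, sphereUniform, integral_smul_measure, H g hg,
    ENNReal.toReal_inv, smul_eq_mul, ← Measure.real, h1, mul_comm, ← div_eq_mul_inv,
    mul_div_mul_left _ _ hc]
end
end

section
/- Let n ≥ m ≥ 1 and let A ∈ M_{n×m}(ℂ) have m distinct nonzero singular values. Suppose A = U₁ Σ V* = U₁' Σ' V'*, where U₁, U₁' are n×m matrices with orthonormal columns, Σ, Σ' are m×m diagonal matrices with strictly increasing positive diagonal entries, and V, V' are m×m unitary matrices all of whose diagonal entries are positive real numbers. Then U₁ = U₁', Σ = Σ', and V = V'. (Uniqueness of the 'modified singular value decomposition'.) -/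
open Matrix

noncomputable section

/-- If `W` intertwines two diagonal matrices, its nonzero entries match equal diagonal entries. -/
lemma eq_of_mul_diagonal_eq {ι R : Type*} [Fintype ι] [DecidableEq ι] [CommRing R] [IsDomain R]
    {W : Matrix ι ι R} {d d' : ι → R} (h : W * diagonal d = diagonal d' * W) {i j : ι}
    (hW : W i j ≠ 0) : d j = d' i := by
  have hij := congrFun (congrFun h i) j
  rw [mul_diagonal, diagonal_mul, mul_comm] at hij
  exact mul_right_cancel₀ hW hij

/-- An invertible matrix has no zero column. -/
lemma exists_apply_ne_zero_of_mul_eq_one {ι R : Type*} [Fintype ι] [DecidableEq ι]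
    [CommRing R] [Nontrivial R] {B W : Matrix ι ι R} (h : B * W = 1) (j : ι) :
    ∃ i, W i j ≠ 0 := by
  by_contra! hz
  have hjj := congrFun (congrFun h j) j
  simp [mul_apply, hz] at hjj

/-- The Gram matrix of `U * diagonal σ * Vᴴ`, for `U` with orthonormal columns. -/
lemma conjTranspose_mul_self_of_svd {κ ι : Type*} [Fintype κ] [Fintype ι] [DecidableEq ι]
    {U : Matrix κ ι ℂ} (hU : Uᴴ * U = 1) (σ : ι → ℝ) (V : Matrix ι ι ℂ) :
    (U * diagonal (fun i => (σ i : ℂ)) * Vᴴ)ᴴ * (U * diagonal (fun i => (σ i : ℂ)) * Vᴴ) =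
      V * diagonal (fun i => ((σ i ^ 2 : ℝ) : ℂ)) * Vᴴ := by
  have hD : (diagonal (fun i => (σ i : ℂ)))ᴴ = diagonal (fun i => (σ i : ℂ)) := by
    rw [diagonal_conjTranspose]
    congr 1
    ext i
    simp
  rw [conjTranspose_mul, conjTranspose_mul, conjTranspose_conjTranspose, hD]
  calc V * (diagonal (fun i => (σ i : ℂ)) * Uᴴ) * (U * diagonal (fun i => (σ i : ℂ)) * Vᴴ)
      = V * (diagonal (fun i => (σ i : ℂ)) * (Uᴴ * U) * diagonal (fun i => (σ i : ℂ))) * Vᴴ := by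
        simp only [Matrix.mul_assoc]
    _ = _ := by
        rw [hU, Matrix.mul_one, diagonal_mul_diagonal]
        simp only [pow_two, Complex.ofReal_mul]

/-- A complex number of modulus one that is a ratio of positive reals equals one. -/
lemma eq_one_of_star_mul_self_of_eq_mul {a b w : ℂ} (ha : 0 < a.re ∧ a.im = 0)
    (hb : 0 < b.re ∧ b.im = 0) (hw : star w * w = 1) (h : b = a * w) : w = 1 := by
  have hre := congrArg Complex.re h
  have him := congrArg Complex.im h
  have hn := congrArg Complex.re hw
  simp only [Complex.mul_re, Complex.mul_im, ha.2, hb.2, zero_mul, sub_zero, add_zero] at hre him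
  have hwim : w.im = 0 := (mul_eq_zero.mp him.symm).resolve_left ha.1.ne'
  have hwre : 0 < w.re := (mul_pos_iff_of_pos_left ha.1).mp (hre ▸ hb.1)
  simp [hwim] at hn
  apply Complex.ext
  · simp only [Complex.one_re]
    nlinarith
  · simpa using hwim

/-- Uniqueness of the "modified singular value decomposition".
Let `n ≥ m ≥ 1` and let `A` be an `n × m` complex matrix with `m` distinct
nonzero singular values.  Suppose `A = U₁ Σ V* = U₁' Σ' V'*`, where `U₁, U₁'`
are `n × m` matrices with orthonormal columns, `Σ, Σ'` are `m × m` diagonal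
matrices with strictly increasing positive diagonal entries, and `V, V'` are
`m × m` unitary matrices all of whose diagonal entries are positive real
numbers.  Then `U₁ = U₁'`, `Σ = Σ'` and `V = V'`. -/
theorem modified_svd_unique (m n : ℕ) (hm : 1 ≤ m) (hmn : m ≤ n)
    (A : Matrix (Fin n) (Fin m) ℂ)
    (U U' : Matrix (Fin n) (Fin m) ℂ)
    (hU : Uᴴ * U = 1) (hU' : U'ᴴ * U' = 1)
    (σ σ' : Fin m → ℝ)
    (hσmono : StrictMono σ) (hσ'mono : StrictMono σ')
    (hσpos : ∀ i, 0 < σ i) (hσ'pos : ∀ i, 0 < σ' i)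
    (V V' : Matrix (Fin m) (Fin m) ℂ)
    (hV : V ∈ Matrix.unitaryGroup (Fin m) ℂ)
    (hV' : V' ∈ Matrix.unitaryGroup (Fin m) ℂ)
    (hVdiag : ∀ i, 0 < (V i i).re ∧ (V i i).im = 0)
    (hV'diag : ∀ i, 0 < (V' i i).re ∧ (V' i i).im = 0)
    (hA : A = U * Matrix.diagonal (fun i => (σ i : ℂ)) * Vᴴ)
    (hA' : A = U' * Matrix.diagonal (fun i => (σ' i : ℂ)) * V'ᴴ) :
    U = U' ∧ σ = σ' ∧ V = V' := by
  have hVV : Vᴴ * V = 1 := mem_unitaryGroup_iff'.mp hV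
  have hVV' : V'ᴴ * V' = 1 := mem_unitaryGroup_iff'.mp hV'
  have hVVr' : V' * V'ᴴ = 1 := mem_unitaryGroup_iff.mp hV'
  have hVVr : V * Vᴴ = 1 := mem_unitaryGroup_iff.mp hV
  have hgram : V * diagonal (fun i => ((σ i ^ 2 : ℝ) : ℂ)) * Vᴴ =
      V' * diagonal (fun i => ((σ' i ^ 2 : ℝ) : ℂ)) * V'ᴴ := by
    rw [← conjTranspose_mul_self_of_svd hU, ← conjTranspose_mul_self_of_svd hU', ← hA, ← hA']
  set W := V'ᴴ * V with hWdef
  have hWstar : Wᴴ = Vᴴ * V' := by simp [hWdef]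
  have hWW : Wᴴ * W = 1 := by
    rw [hWstar, hWdef, Matrix.mul_assoc, ← Matrix.mul_assoc V', hVVr', Matrix.one_mul, hVV]
  have hWWr : W * Wᴴ = 1 := mul_eq_one_comm.mp hWW
  have hVW : V = V' * W := by rw [hWdef, ← Matrix.mul_assoc, hVVr', Matrix.one_mul]
  have hinter : W * diagonal (fun i => ((σ i ^ 2 : ℝ) : ℂ)) =
      diagonal (fun i => ((σ' i ^ 2 : ℝ) : ℂ)) * W := by
    have h := congrArg (fun M => V'ᴴ * M * V) hgram
    simp only [Matrix.mul_assoc, hVV, Matrix.mul_one] at h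
    rw [← Matrix.mul_assoc V'ᴴ V' _, hVV', Matrix.one_mul] at h
    rw [hWdef, Matrix.mul_assoc, h]
  have hmatch : ∀ i j, W i j ≠ 0 → σ j = σ' i := fun i j hij => by
    have h := Complex.ofReal_injective (eq_of_mul_diagonal_eq hinter hij)
    exact (pow_left_inj₀ (hσpos j).le (hσ'pos i).le two_ne_zero).mp h
  have hσ : σ = σ' := by
    refine (hσmono.range_inj hσ'mono).mp (Set.Subset.antisymm ?_ ?_)
    · rintro _ ⟨j, rfl⟩
      obtain ⟨i, hi⟩ := exists_apply_ne_zero_of_mul_eq_one hWW j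
      exact ⟨i, (hmatch i j hi).symm⟩
    · rintro _ ⟨i, rfl⟩
      obtain ⟨j, hj⟩ := exists_apply_ne_zero_of_mul_eq_one hWWr i
      exact ⟨j, hmatch i j (by simpa using hj)⟩
  subst hσ
  have hoff : ∀ i j, i ≠ j → W i j = 0 := fun i j hij => by
    by_contra h
    exact hij (hσmono.injective (hmatch i j h)).symm
  have hWone : W = 1 := by
    ext i j
    rcases eq_or_ne i j with rfl | hij
    · rw [one_apply_eq]
      refine eq_one_of_star_mul_self_of_eq_mul (hV'diag i) (hVdiag i) ?_ ?_
      · have h := congrFun (congrFun hWW i) i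
        rwa [mul_apply, Finset.sum_eq_single i (fun k _ hk => by rw [hoff k i hk, mul_zero])
          (by simp), conjTranspose_apply, one_apply_eq] at h
      · have h := congrFun (congrFun hVW i) i
        rwa [mul_apply, Finset.sum_eq_single i (fun k _ hk => by rw [hoff k i hk, mul_zero])
          (by simp)] at h
    · rw [hoff i j hij, one_apply_ne hij]
  have hVeq : V = V' := by rw [hVW, hWone, Matrix.mul_one]
  refine ⟨?_, rfl, hVeq⟩
  subst hVeq
  have hUD : U * diagonal (fun i => (σ i : ℂ)) = U' * diagonal (fun i => (σ i : ℂ)) := by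
    have h := congrArg (· * V) (hA.symm.trans hA')
    simpa only [Matrix.mul_assoc, hVV, Matrix.mul_one] using h
  ext i j
  have h := congrFun (congrFun hUD i) j
  rw [mul_diagonal, mul_diagonal] at h
  exact mul_right_cancel₀ (Complex.ofReal_ne_zero.mpr (hσpos j).ne') h
end
end
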